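/- arXiv:2502.18678 — 2 statements merged into one kernel-verified Lean document; each statement's English description precedes it below -/
import Mathlib

section
/- There exists a constant C > 0 such that for every k_F ≥ 2 and every k ∈ ℤ³ with 0 < |k| < 2k_F, one has D₁(k, k_F) ≤ C k_F (1 + (ln k_F)^{5/3} k_F^{−1/3} |k|⁴). -/
open scoped BigOperators

/-- The Euclidean norm of a lattice point `k ∈ ℤ³`. -/
noncomputable def znorm (k : Fin 3 → ℤ) : ℝ := Real.sqrt (∑ i, ((k i : ℝ))^2)

/-- The lune set `L(k) = {p ∈ ℤ³ : |p| > k_F and |p − k| ≤ k_F}`. -/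
def lune (kF : ℝ) (k : Fin 3 → ℤ) : Set (Fin 3 → ℤ) :=
  {p | kF < znorm p ∧ znorm (p - k) ≤ kF}

/- The resolvent sum `D_α(k, k_F) = Σ_{p ∈ L(k)} (|p|² − |p − k|²)^{−α}`
(a finite sum, written as a `tsum` of the indicator; the power is a real power). -/
open Classical in
noncomputable def Dsum (α kF : ℝ) (k : Fin 3 → ℤ) : ℝ :=
  ∑' p : Fin 3 → ℤ,
    if p ∈ lune kF k then ((znorm p) ^ 2 - (znorm (p - k)) ^ 2) ^ (-α) else 0

/-- The squared Euclidean norm of a lattice point. -/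
def sqNorm (p : Fin 3 → ℤ) : ℤ := p 0 ^ 2 + p 1 ^ 2 + p 2 ^ 2

/-- The energy gap `|p|² − |p − k|²`. -/
def gap (k p : Fin 3 → ℤ) : ℤ :=
  2 * (p 0 * k 0 + p 1 * k 1 + p 2 * k 2) - sqNorm k

lemma znorm_sq (p : Fin 3 → ℤ) : znorm p ^ 2 = sqNorm p := by
  rw [znorm, Real.sq_sqrt (Finset.sum_nonneg fun i _ => sq_nonneg _), Fin.sum_univ_three, sqNorm]
  push_cast
  rfl

lemma znorm_nonneg (p : Fin 3 → ℤ) : 0 ≤ znorm p := Real.sqrt_nonneg _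

lemma sqNorm_sub (k p : Fin 3 → ℤ) : sqNorm (p - k) = sqNorm p - gap k p := by
  simp only [sqNorm, gap, Pi.sub_apply]
  ring

lemma mem_lune_iff {R : ℝ} (hR : 0 ≤ R) {k p : Fin 3 → ℤ} :
    p ∈ lune R k ↔ R ^ 2 < sqNorm p ∧ (sqNorm p : ℝ) - gap k p ≤ R ^ 2 := by
  have h : ((sqNorm p : ℤ) : ℝ) - gap k p = sqNorm (p - k) := by
    rw [sqNorm_sub]; push_cast; rfl
  rw [h, ← znorm_sq, ← znorm_sq, sq_lt_sq₀ hR (znorm_nonneg p), sq_le_sq₀ (znorm_nonneg _) hR]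
  rfl

lemma gap_pos {R : ℝ} (hR : 0 ≤ R) {k p : Fin 3 → ℤ} (hp : p ∈ lune R k) : 0 < gap k p := by
  rw [mem_lune_iff hR] at hp
  have : (0 : ℝ) < gap k p := by linarith
  exact_mod_cast this

/-! ### Counting lemmas -/

/-- A finite set of integers of diameter at most `D` has at most `D + 1` elements. -/
lemma card_le_of_diam {B : Finset ℤ} {D : ℝ} (hD : 0 ≤ D)
    (h : ∀ b ∈ B, ∀ c ∈ B, (c : ℝ) - b ≤ D) : (B.card : ℝ) ≤ D + 1 := by
  rcases B.eq_empty_or_nonempty with rfl | hB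
  · simp; linarith
  · have hsub : B ⊆ Finset.Icc (B.min' hB) (B.max' hB) := fun b hb =>
      Finset.mem_Icc.2 ⟨B.min'_le b hb, B.le_max' b hb⟩
    have h1 := Finset.card_le_card hsub
    rw [Int.card_Icc] at h1
    have h2 := h _ (B.min'_mem hB) _ (B.max'_mem hB)
    have h3 : B.min' hB ≤ B.max' hB := B.min'_le _ (B.max'_mem hB)
    have h4 : (B.card : ℤ) ≤ B.max' hB + 1 - B.min' hB := by omega
    have h5 : (B.card : ℝ) ≤ B.max' hB + 1 - B.min' hB := by exact_mod_cast h4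
    linarith

lemma card_le_of_rows {ι κ : Type*} [DecidableEq κ] {F : Finset ι} {x : ι → κ} {y : ι → ℤ}
    {S : Finset κ} {D : ℝ} (hD : 0 ≤ D) (hS : ∀ p ∈ F, x p ∈ S)
    (hinj : ∀ p ∈ F, ∀ q ∈ F, x p = x q → y p = y q → p = q)
    (hdiam : ∀ p ∈ F, ∀ q ∈ F, x p = x q → (y q : ℝ) - y p ≤ D) :
    (F.card : ℝ) ≤ S.card * (D + 1) := by
  classical
  rw [Finset.card_eq_sum_card_fiberwise (f := x) (t := S) hS]
  push_cast
  rw [← nsmul_eq_mul]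
  refine Finset.sum_le_card_nsmul _ _ _ fun c _ => ?_
  have hcard : (F.filter (x · = c)).card = ((F.filter (x · = c)).image y).card := by
    rw [Finset.card_image_of_injOn]
    intro p hp q hq hpq
    simp only [Finset.coe_filter, Set.mem_ofPred_eq] at hp hq
    exact hinj p hp.1 q hq.1 (hp.2.trans hq.2.symm) hpq
  rw [hcard]
  refine card_le_of_diam hD ?_
  simp only [Finset.mem_image, Finset.mem_filter]
  rintro _ ⟨p, hp, rfl⟩ _ ⟨q, hq, rfl⟩
  exact hdiam p hp.1 q hq.1 (hp.2.trans hq.2.symm)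

lemma card_Icc_floor_le {M : ℝ} (hM : 0 ≤ M) :
    ((Finset.Icc (-⌊M⌋) ⌊M⌋).card : ℝ) ≤ 2 * M + 1 := by
  have h0 : 0 ≤ ⌊M⌋ := Int.floor_nonneg.2 hM
  have h1 := Int.floor_le M
  have h2 : ((Finset.Icc (-⌊M⌋) ⌊M⌋).card : ℤ) = 2 * ⌊M⌋ + 1 := by
    rw [Int.card_Icc]; omega
  have h3 : ((Finset.Icc (-⌊M⌋) ⌊M⌋).card : ℝ) = 2 * ⌊M⌋ + 1 := by exact_mod_cast h2
  linarith

lemma mem_Icc_floor {M : ℝ} {a : ℤ} (h : |(a : ℝ)| ≤ M) : a ∈ Finset.Icc (-⌊M⌋) ⌊M⌋ := by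
  rw [abs_le] at h
  rw [Finset.mem_Icc, neg_le]
  refine ⟨Int.le_floor.2 ?_, Int.le_floor.2 h.2⟩
  push_cast
  linarith

/-- Points of a thin annulus at which the `y`-derivative `2 g` of the defining quadratic form `q`
is large. -/
lemma card_le_of_grad {ι : Type*} {F : Finset ι} {x y : ι → ℤ} {q g : ι → ℝ} {A H M r : ℝ}
    (hH : 0 ≤ H) (hM : 0 ≤ M) (hr : 0 < r) (hx : ∀ p ∈ F, |(x p : ℝ)| ≤ M)
    (hinj : ∀ p ∈ F, ∀ p' ∈ F, x p = x p' → y p = y p' → p = p')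
    (hq : ∀ p ∈ F, A ≤ q p ∧ q p ≤ A + H) (hg : ∀ p ∈ F, r ≤ g p)
    (hqg : ∀ p ∈ F, ∀ p' ∈ F, x p = x p' → q p' - q p = (y p' - y p) * (g p + g p')) :
    (F.card : ℝ) ≤ (2 * M + 1) * (H / (2 * r) + 1) := by
  have hD : 0 ≤ H / (2 * r) := by positivity
  refine (card_le_of_rows hD (fun p hp => mem_Icc_floor (hx p hp)) hinj ?_).trans
    (mul_le_mul_of_nonneg_right (card_Icc_floor_le hM) (by linarith))
  intro p hp p' hp' hxx
  rw [le_div_iff₀ (by positivity)]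
  have h1 := hqg p hp p' hp' hxx
  have h2 := hg p hp
  have h3 := hg p' hp'
  have h4 := (hq p hp).1
  have h5 := (hq p' hp').2
  by_cases h : (y p' : ℝ) - y p ≤ 0
  · nlinarith
  · push Not at h
    nlinarith

lemma card_le_of_abs_grad {ι : Type*} {F : Finset ι} {x y : ι → ℤ} {q g : ι → ℝ} {A H M r : ℝ}
    (hH : 0 ≤ H) (hM : 0 ≤ M) (hr : 0 < r) (hx : ∀ p ∈ F, |(x p : ℝ)| ≤ M)
    (hinj : ∀ p ∈ F, ∀ p' ∈ F, x p = x p' → y p = y p' → p = p')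
    (hq : ∀ p ∈ F, A ≤ q p ∧ q p ≤ A + H) (hg : ∀ p ∈ F, r ≤ |g p|)
    (hqg : ∀ p ∈ F, ∀ p' ∈ F, x p = x p' → q p' - q p = (y p' - y p) * (g p + g p')) :
    (F.card : ℝ) ≤ 2 * ((2 * M + 1) * (H / (2 * r) + 1)) := by
  classical
  have hpos := card_le_of_grad (F := F.filter (0 ≤ g ·)) (x := x) (y := y) (q := q) (g := g)
    hH hM hr
    (fun p hp => hx p (Finset.mem_filter.1 hp).1)
    (fun p hp p' hp' => hinj p (Finset.mem_filter.1 hp).1 p' (Finset.mem_filter.1 hp').1)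
    (fun p hp => hq p (Finset.mem_filter.1 hp).1)
    (fun p hp => by
      have h := Finset.mem_filter.1 hp
      simpa [abs_of_nonneg h.2] using hg p h.1)
    (fun p hp p' hp' => hqg p (Finset.mem_filter.1 hp).1 p' (Finset.mem_filter.1 hp').1)
  have hneg := card_le_of_grad (F := F.filter (¬ 0 ≤ g ·)) (x := x) (y := fun p => - y p) (q := q)
    (g := fun p => - g p) hH hM hr
    (fun p hp => hx p (Finset.mem_filter.1 hp).1)
    (fun p hp p' hp' h1 h2 =>
      hinj p (Finset.mem_filter.1 hp).1 p' (Finset.mem_filter.1 hp').1 h1 (neg_injective h2))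
    (fun p hp => hq p (Finset.mem_filter.1 hp).1)
    (fun p hp => by
      have h := Finset.mem_filter.1 hp
      simpa [abs_of_neg (not_le.1 h.2)] using hg p h.1)
    (fun p hp p' hp' h1 => by
      rw [hqg p (Finset.mem_filter.1 hp).1 p' (Finset.mem_filter.1 hp').1 h1]
      push_cast
      ring)
  have hsum : ((F.filter (0 ≤ g ·)).card : ℝ) + (F.filter (¬ 0 ≤ g ·)).card = F.card := by
    exact_mod_cast Finset.card_filter_add_card_filter_not (s := F) (0 ≤ g ·)
  linarith

/-! ### Sums of inverse square roots along a row -/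

lemma sum_inv_sqrt_le (N : ℕ) :
    ∑ i ∈ Finset.range N, 1 / Real.sqrt (i + 1) ≤ 2 * Real.sqrt N := by
  induction N with
  | zero => simp
  | succ N ih =>
    rw [Finset.sum_range_succ]
    have h1 : 0 < Real.sqrt ((N : ℝ) + 1) := Real.sqrt_pos.2 (by positivity)
    have h2 := Real.sq_sqrt (show (0 : ℝ) ≤ (N : ℝ) + 1 by positivity)
    have h3 := Real.sq_sqrt (show (0 : ℝ) ≤ (N : ℝ) by positivity)
    have h5 : 1 / Real.sqrt ((N : ℝ) + 1) ≤ 2 * (Real.sqrt ((N : ℝ) + 1) - Real.sqrt N) := by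
      rw [div_le_iff₀ h1]
      nlinarith [sq_nonneg (Real.sqrt ((N : ℝ) + 1) - Real.sqrt N)]
    push_cast
    linarith

lemma sum_inv_sqrt_half_row {ι : Type*} {F : Finset ι} {x : ι → ℝ} {X α : ℝ}
    (hα : 1 / 2 ≤ α) (hx : ∀ p ∈ F, 0 ≤ x p)
    (hsep : ∀ p ∈ F, ∀ q ∈ F, p ≠ q → 1 ≤ |x p - x q|)
    (hX : ∀ p ∈ F, 1 ≤ X - α * x p ^ 2) :
    ∑ p ∈ F, 1 / Real.sqrt (X - α * x p ^ 2) ≤ 4 := by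
  classical
  rcases F.eq_empty_or_nonempty with rfl | ⟨p₀, hp₀⟩
  · simp
  have hα0 : 0 < α := by linarith
  have hX1 : 1 ≤ X := by nlinarith [hX p₀ hp₀, sq_nonneg (x p₀)]
  set m := Real.sqrt (X / α) with hm
  have hm0 : 0 < m := Real.sqrt_pos.2 (by positivity)
  have hm2 : α * m ^ 2 = X := by
    rw [hm, Real.sq_sqrt (by positivity)]; field_simp
  have hxm : ∀ p ∈ F, x p < m := fun p hp => by
    by_contra! h
    nlinarith [hX p hp, mul_le_mul_of_nonneg_left (pow_le_pow_left₀ hm0.le h 2) hα0.le]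
  let φ : ι → ℕ := fun p => ⌊m - x p⌋₊
  let b : ℕ → ℝ := fun i => if i = 0 then 1 else Real.sqrt 2 / Real.sqrt m * (1 / Real.sqrt i)
  have hb : ∀ i, 0 ≤ b i := fun i => by
    simp only [b]; split_ifs <;> positivity
  have hφ : Set.InjOn φ F := by
    intro p hp q hq hpq
    by_contra hne
    have h1 := hsep p hp q hq hne
    have h2 := Nat.floor_le (sub_nonneg.2 (hxm p hp).le)
    have h3 := Nat.floor_le (sub_nonneg.2 (hxm q hq).le)
    have h4 := Nat.lt_floor_add_one (m - x p)
    have h5 := Nat.lt_floor_add_one (m - x q)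
    have h6 : (⌊m - x p⌋₊ : ℝ) = ⌊m - x q⌋₊ := by exact_mod_cast hpq
    rcases le_abs.1 h1 with h | h <;> linarith
  have hterm : ∀ p ∈ F, 1 / Real.sqrt (X - α * x p ^ 2) ≤ b (φ p) := by
    intro p hp
    simp only [b]
    split_ifs with h
    · rw [div_le_one (Real.sqrt_pos.2 (by linarith [hX p hp]))]
      exact Real.one_le_sqrt.2 (hX p hp)
    · have hi : (0 : ℝ) < φ p := by exact_mod_cast Nat.pos_of_ne_zero h
      have h2 : (φ p : ℝ) ≤ m - x p := Nat.floor_le (sub_nonneg.2 (hxm p hp).le)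
      have h3 : m * φ p / 2 ≤ X - α * x p ^ 2 := by
        have e : X - α * x p ^ 2 = α * ((m - x p) * (m + x p)) := by rw [← hm2]; ring
        have h4 : m * φ p ≤ (m - x p) * (m + x p) := by nlinarith [hx p hp]
        have h5 : 0 ≤ m * φ p := by positivity
        rw [e]
        nlinarith
      have h4 : Real.sqrt 2 / Real.sqrt m * (1 / Real.sqrt (φ p))
          = 1 / Real.sqrt (m * φ p / 2) := by
        rw [Real.sqrt_div (by positivity), Real.sqrt_mul hm0.le]
        field_simp
      rw [h4]
      exact one_div_le_one_div_of_le (Real.sqrt_pos.2 (by positivity)) (Real.sqrt_le_sqrt h3)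
  have hrange : F.image φ ⊆ Finset.range (⌊m⌋₊ + 1) := by
    intro i hi
    obtain ⟨p, hp, rfl⟩ := Finset.mem_image.1 hi
    exact Finset.mem_range.2 (Nat.lt_succ_of_le (Nat.floor_le_floor (by linarith [hx p hp])))
  calc ∑ p ∈ F, 1 / Real.sqrt (X - α * x p ^ 2) ≤ ∑ p ∈ F, b (φ p) := Finset.sum_le_sum hterm
    _ = ∑ i ∈ F.image φ, b i := (Finset.sum_image hφ).symm
    _ ≤ ∑ i ∈ Finset.range (⌊m⌋₊ + 1), b i :=
      Finset.sum_le_sum_of_subset_of_nonneg hrange fun i _ _ => hb i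
    _ = Real.sqrt 2 / Real.sqrt m * ∑ i ∈ Finset.range ⌊m⌋₊, 1 / Real.sqrt (i + 1) + 1 := by
      rw [Finset.sum_range_succ', Finset.mul_sum]
      simp [b]
    _ ≤ Real.sqrt 2 / Real.sqrt m * (2 * Real.sqrt m) + 1 := by
      gcongr
      refine (sum_inv_sqrt_le _).trans ?_
      gcongr
      exact Nat.floor_le hm0.le
    _ = 2 * Real.sqrt 2 + 1 := by
      have := Real.sqrt_pos.2 hm0
      field_simp
    _ ≤ 4 := by
      nlinarith [Real.sq_sqrt (show (0 : ℝ) ≤ 2 by norm_num), Real.sqrt_nonneg 2]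

lemma sum_inv_sqrt_row {ι : Type*} {F : Finset ι} {x : ι → ℝ} {X α : ℝ}
    (hα : 1 / 2 ≤ α) (hsep : ∀ p ∈ F, ∀ q ∈ F, p ≠ q → 1 ≤ |x p - x q|)
    (hX : ∀ p ∈ F, 1 ≤ X - α * x p ^ 2) :
    ∑ p ∈ F, 1 / Real.sqrt (X - α * x p ^ 2) ≤ 8 := by
  classical
  rw [← Finset.sum_filter_add_sum_filter_not F (0 ≤ x ·)]
  have h1 := sum_inv_sqrt_half_row (F := F.filter (0 ≤ x ·)) (x := x) hα
    (fun p hp => (Finset.mem_filter.1 hp).2)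
    (fun p hp q hq => hsep p (Finset.mem_filter.1 hp).1 q (Finset.mem_filter.1 hq).1)
    (fun p hp => hX p (Finset.mem_filter.1 hp).1)
  have h2 := sum_inv_sqrt_half_row (F := F.filter (¬ 0 ≤ x ·)) (x := fun p => - x p) (X := X) hα
    (fun p hp => by linarith [not_le.1 (Finset.mem_filter.1 hp).2])
    (fun p hp q hq hpq => by
      rw [neg_sub_neg, abs_sub_comm]
      exact hsep p (Finset.mem_filter.1 hp).1 q (Finset.mem_filter.1 hq).1 hpq)
    (fun p hp => by simpa using hX p (Finset.mem_filter.1 hp).1)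
  simp only [neg_sq] at h2
  linarith

/-! ### The two parts of the lune -/

/-- Lagrange's identity in the coordinates of the projection along `(k₀, k₁, n)`. -/
lemma lagrange_shear {k₀ k₁ n : ℝ} (hn : n ≠ 0) (a b t : ℝ) :
    (k₀ ^ 2 + k₁ ^ 2 + n ^ 2) * (a ^ 2 + b ^ 2 + t ^ 2) - (a * k₀ + b * k₁ + t * n) ^ 2 =
      (k₀ ^ 2 + k₁ ^ 2 + n ^ 2) * ((a - k₀ / n * t) ^ 2 + (b - k₁ / n * t) ^ 2) -
        (k₀ * (a - k₀ / n * t) + k₁ * (b - k₁ / n * t)) ^ 2 := by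
  field_simp
  ring

/-- A point whose product with `(k₀, k₁, n)` is small has a large projection. -/
lemma norm_sq_sub_le_shear {k₀ k₁ n a b t : ℝ} (hn : n ≠ 0) (h0 : 0 ≤ a * k₀ + b * k₁ + t * n)
    (h : a * k₀ + b * k₁ + t * n ≤ 6 * n ^ 2) :
    a ^ 2 + b ^ 2 + t ^ 2 - 36 * n ^ 2 ≤ (a - k₀ / n * t) ^ 2 + (b - k₁ / n * t) ^ 2 := by
  have hid := lagrange_shear (k₀ := k₀) (k₁ := k₁) hn a b t
  have hK : 0 < k₀ ^ 2 + k₁ ^ 2 + n ^ 2 := by positivity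
  have h1 : (a * k₀ + b * k₁ + t * n) ^ 2 ≤ (k₀ ^ 2 + k₁ ^ 2 + n ^ 2) * (36 * n ^ 2) := by
    calc (a * k₀ + b * k₁ + t * n) ^ 2 ≤ (6 * n ^ 2) ^ 2 := pow_le_pow_left₀ h0 h 2
      _ = n ^ 2 * (36 * n ^ 2) := by ring
      _ ≤ _ := by
        gcongr
        linarith [sq_nonneg k₀, sq_nonneg k₁]
  refine le_of_mul_le_mul_left ?_ hK
  linarith [sq_nonneg (k₀ * (a - k₀ / n * t) + k₁ * (b - k₁ / n * t))]

set_option maxHeartbeats 1000000 in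
/-- The points of the lune with gap in a window of length `2 k₂` lie near a circle. -/
lemma card_window_le {R : ℝ} {k : Fin 3 → ℤ} (hk : 0 < k 2) (hk0 : |k 0| ≤ k 2)
    (hk1 : |k 1| ≤ k 2) (hkR : 100 * (k 2 : ℝ) ≤ R) {J : ℤ} (hJ : 0 ≤ J)
    (hJk : 2 * J ≤ 9 * k 2) {F : Finset (Fin 3 → ℤ)} (hF : ∀ p ∈ F, p ∈ lune R k)
    (hgap : ∀ p ∈ F, gap k p / (2 * k 2) = J) :
    (F.card : ℝ) ≤ 320 * (R + k 2 * J) := by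
  classical
  have hn1 : (1 : ℝ) ≤ k 2 := by exact_mod_cast hk
  have hk0' : (k 0 : ℝ) ^ 2 ≤ (k 2 : ℝ) ^ 2 := by
    exact_mod_cast sq_le_sq' (abs_le.1 hk0).1 (abs_le.1 hk0).2
  have hk1' : (k 1 : ℝ) ^ 2 ≤ (k 2 : ℝ) ^ 2 := by
    exact_mod_cast sq_le_sq' (abs_le.1 hk1).1 (abs_le.1 hk1).2
  have hJ' : (0 : ℝ) ≤ J := by exact_mod_cast hJ
  have hJk' : 2 * (J : ℝ) ≤ 9 * k 2 := by exact_mod_cast hJk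
  have hwin : ∀ p ∈ F, 2 * (k 2 : ℝ) * J ≤ gap k p ∧ (gap k p : ℝ) ≤ 2 * k 2 * J + 2 * k 2 := by
    intro p hp
    have h1 := Int.mul_ediv_add_emod (gap k p) (2 * k 2)
    have h2 := Int.emod_nonneg (gap k p) (show 2 * k 2 ≠ 0 by omega)
    have h3 := Int.emod_lt_of_pos (gap k p) (show 0 < 2 * k 2 by omega)
    rw [hgap p hp] at h1
    constructor
    · have : 2 * k 2 * J ≤ gap k p := by omega
      exact_mod_cast this
    · have : gap k p ≤ 2 * k 2 * J + 2 * k 2 := by omega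
      exact_mod_cast this
  have hinj : ∀ p ∈ F, ∀ p' ∈ F, p 0 = p' 0 → p 1 = p' 1 → p = p' := by
    intro p hp p' hp' h0 h1
    have e1 := Int.mul_ediv_add_emod (gap k p) (2 * k 2)
    have e2 := Int.mul_ediv_add_emod (gap k p') (2 * k 2)
    rw [hgap p hp] at e1
    rw [hgap p' hp'] at e2
    have h2 := Int.emod_nonneg (gap k p) (show 2 * k 2 ≠ 0 by omega)
    have h3 := Int.emod_lt_of_pos (gap k p) (show 0 < 2 * k 2 by omega)
    have h4 := Int.emod_nonneg (gap k p') (show 2 * k 2 ≠ 0 by omega)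
    have h5 := Int.emod_lt_of_pos (gap k p') (show 0 < 2 * k 2 by omega)
    have e3 : gap k p - gap k p' = 2 * k 2 * (p 2 - p' 2) := by
      simp only [gap, h0, h1]; ring
    have h6 : p 2 = p' 2 := by
      rcases lt_trichotomy (p 2) (p' 2) with h | h | h
      · nlinarith
      · exact h
      · nlinarith
    ext i
    fin_cases i <;> assumption
  set n : ℝ := ((k 2 : ℤ) : ℝ) with hn
  have hn0 : n ≠ 0 := by linarith
  have hK : (sqNorm k : ℝ) = (k 0 : ℝ) ^ 2 + (k 1 : ℝ) ^ 2 + n ^ 2 := by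
    simp only [sqNorm]; push_cast; rfl
  set K : ℝ := ((sqNorm k : ℤ) : ℝ) with hKdef
  have hKn : n ^ 2 ≤ K := by nlinarith [sq_nonneg (k 0 : ℝ), sq_nonneg (k 1 : ℝ)]
  have hK3 : K ≤ 3 * n ^ 2 := by linarith
  have hK0 : 0 < K := (by positivity : 0 < n ^ 2).trans_le hKn
  let t : (Fin 3 → ℤ) → ℝ := fun p => (K + 2 * n * J - 2 * (p 0 * k 0 + p 1 * k 1)) / (2 * n)
  let q : (Fin 3 → ℤ) → ℝ := fun p => (p 0 : ℝ) ^ 2 + (p 1 : ℝ) ^ 2 + t p ^ 2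
  let g₀ : (Fin 3 → ℤ) → ℝ := fun p => p 0 - k 0 / n * t p
  let g₁ : (Fin 3 → ℤ) → ℝ := fun p => p 1 - k 1 / n * t p
  have hgapR : ∀ p, (gap k p : ℝ) = 2 * (p 0 * k 0 + p 1 * k 1 + p 2 * n) - K := by
    intro p; simp only [gap, hKdef]; push_cast; rfl
  have ht : ∀ p ∈ F, t p ≤ p 2 ∧ p 2 ≤ t p + 1 := by
    intro p hp
    have h := hwin p hp
    rw [hgapR] at h
    simp only [t]
    constructor
    · rw [div_le_iff₀ (by linarith)]; nlinarith
    · rw [← sub_le_iff_le_add, le_div_iff₀ (by linarith)]; nlinarith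
  have hnorm : ∀ p ∈ F, R ^ 2 ≤ sqNorm p ∧ (sqNorm p : ℝ) ≤ R ^ 2 + (2 * n * J + 2 * n) := by
    intro p hp
    have h := (mem_lune_iff (by linarith)).1 (hF p hp)
    exact ⟨h.1.le, by linarith [(hwin p hp).2]⟩
  have hsq : ∀ p : Fin 3 → ℤ, (sqNorm p : ℝ) = (p 0 : ℝ) ^ 2 + (p 1 : ℝ) ^ 2 + (p 2 : ℝ) ^ 2 := by
    intro p; simp only [sqNorm]; push_cast; rfl
  have hbig : 2 * n * J + 2 * n ≤ 3 * R ^ 2 := by nlinarith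
  have hcoord : ∀ p ∈ F, ∀ i, |(p i : ℝ)| ≤ 2 * R := by
    intro p hp i
    have h := (hnorm p hp).2
    rw [hsq] at h
    refine abs_le_of_sq_le_sq ?_ (by linarith)
    fin_cases i <;>
    · simp only [Fin.zero_eta, Fin.mk_one, Fin.reduceFinMk]
      nlinarith [sq_nonneg (p 0 : ℝ), sq_nonneg (p 1 : ℝ), sq_nonneg (p 2 : ℝ)]
  have hq : ∀ p ∈ F, R ^ 2 - 4 * R - 1 ≤ q p ∧
      q p ≤ R ^ 2 - 4 * R - 1 + (2 * n * J + 10 * R) := by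
    intro p hp
    have h1 := hnorm p hp
    rw [hsq] at h1
    have h2 := ht p hp
    have h3 := abs_le.1 (hcoord p hp 2)
    have h4 : t p ^ 2 ≤ (p 2 : ℝ) ^ 2 + 4 * R + 1 := by nlinarith
    have h5 : (p 2 : ℝ) ^ 2 ≤ t p ^ 2 + 4 * R + 1 := by nlinarith
    constructor <;> simp only [q] <;> linarith
  have hgrad : ∀ p ∈ F, R / 3 ≤ |g₀ p| ∨ R / 3 ≤ |g₁ p| := by
    intro p hp
    by_contra! h
    have h0 := sq_lt_sq' (abs_lt.1 h.1).1 (abs_lt.1 h.1).2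
    have h1 := sq_lt_sq' (abs_lt.1 h.2).1 (abs_lt.1 h.2).2
    have hs : (p 0 : ℝ) * k 0 + p 1 * k 1 + t p * n = K / 2 + n * J := by
      simp only [t]; field_simp; ring
    have hnJ : n * J ≤ n * (9 * n / 2) := mul_le_mul_of_nonneg_left (by linarith) (by linarith)
    have h5 : q p - 36 * n ^ 2 ≤ g₀ p ^ 2 + g₁ p ^ 2 :=
      norm_sq_sub_le_shear hn0 (by rw [hs]; positivity) (by rw [hs]; linarith)
    have h6 := (hq p hp).1
    have h7 : n ^ 2 ≤ (R / 100) ^ 2 := pow_le_pow_left₀ (by linarith) (by linarith) 2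
    have h8 : 100 * R ≤ R ^ 2 := by nlinarith
    linarith
  have hx₀ : ∀ p p' : Fin 3 → ℤ, p 0 = p' 0 →
      q p' - q p = (p' 1 - p 1) * (g₁ p + g₁ p') := by
    intro p p' h
    simp only [q, g₁, t, h]
    field_simp
    ring
  have hx₁ : ∀ p p' : Fin 3 → ℤ, p 1 = p' 1 →
      q p' - q p = (p' 0 - p 0) * (g₀ p + g₀ p') := by
    intro p p' h
    simp only [q, g₀, t, h]
    field_simp
    ring
  have hR0 : 0 < R := by linarith
  have hH : 0 ≤ 2 * n * J + 10 * R := by positivity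
  have hc₁ := card_le_of_abs_grad (F := F.filter (R / 3 ≤ |g₁ ·|)) (x := (· 0)) (y := (· 1))
    (q := q) (g := g₁) (M := 2 * R) (r := R / 3) hH (by linarith) (by linarith)
    (fun p hp => hcoord p (Finset.mem_filter.1 hp).1 0)
    (fun p hp p' hp' => hinj p (Finset.mem_filter.1 hp).1 p' (Finset.mem_filter.1 hp').1)
    (fun p hp => hq p (Finset.mem_filter.1 hp).1) (fun p hp => (Finset.mem_filter.1 hp).2)
    (fun p _ p' _ => hx₀ p p')
  have hc₀ := card_le_of_abs_grad (F := F.filter (R / 3 ≤ |g₀ ·|)) (x := (· 1)) (y := (· 0))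
    (q := q) (g := g₀) (M := 2 * R) (r := R / 3) hH (by linarith) (by linarith)
    (fun p hp => hcoord p (Finset.mem_filter.1 hp).1 1)
    (fun p hp p' hp' h1 h0 =>
      hinj p (Finset.mem_filter.1 hp).1 p' (Finset.mem_filter.1 hp').1 h0 h1)
    (fun p hp => hq p (Finset.mem_filter.1 hp).1) (fun p hp => (Finset.mem_filter.1 hp).2)
    (fun p _ p' _ => hx₁ p p')
  have hcover : F ⊆ F.filter (R / 3 ≤ |g₀ ·|) ∪ F.filter (R / 3 ≤ |g₁ ·|) := fun p hp => by
    simpa [hp] using hgrad p hp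
  have hcard : (F.card : ℝ) ≤
      (F.filter (R / 3 ≤ |g₀ ·|)).card + (F.filter (R / 3 ≤ |g₁ ·|)).card := by
    exact_mod_cast (Finset.card_le_card hcover).trans (Finset.card_union_le _ _)
  have hfin : (2 * (2 * R) + 1) * ((2 * n * J + 10 * R) / (2 * (R / 3)) + 1) ≤
      15 * n * J + 80 * R := by
    have e : (2 * n * J + 10 * R) / (2 * (R / 3)) + 1 = (3 * n * J + 16 * R) / R := by
      field_simp; ring
    rw [e, ← mul_div_assoc, div_le_iff₀ hR0]
    have : 0 ≤ 3 * n * J + 16 * R := by positivity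
    nlinarith
  have : 0 ≤ n * J := by positivity
  linarith

lemma sum_small_gap_le {R : ℝ} {k : Fin 3 → ℤ} (hk : 0 < k 2) (hk0 : |k 0| ≤ k 2)
    (hk1 : |k 1| ≤ k 2) (hkR : 100 * (k 2 : ℝ) ≤ R) {F : Finset (Fin 3 → ℤ)}
    (hF : ∀ p ∈ F, p ∈ lune R k) (hgap : ∀ p ∈ F, gap k p ≤ 3 * sqNorm k) :
    ∑ p ∈ F, 1 / (gap k p : ℝ) ≤ 4000 * R := by
  classical
  have hn1 : (1 : ℝ) ≤ k 2 := by exact_mod_cast hk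
  have hR0 : 0 ≤ R := by linarith
  have hK3 : sqNorm k ≤ 3 * k 2 ^ 2 := by
    have h0 := sq_le_sq' (abs_le.1 hk0).1 (abs_le.1 hk0).2
    have h1 := sq_le_sq' (abs_le.1 hk1).1 (abs_le.1 hk1).2
    simp only [sqNorm]; linarith
  have hpos : ∀ p ∈ F, 0 < gap k p := fun p hp => gap_pos hR0 (hF p hp)
  have hmem : ∀ p ∈ F, gap k p / (2 * k 2) ∈ Finset.Icc 0 (5 * k 2) := by
    intro p hp
    rw [Finset.mem_Icc]
    refine ⟨Int.ediv_nonneg (hpos p hp).le (by omega), ?_⟩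
    refine Int.ediv_le_of_le_mul (by omega) ?_
    nlinarith [hgap p hp]
  rw [← Finset.sum_fiberwise_of_maps_to hmem]
  have hbound : ∀ J ∈ Finset.Icc 0 (5 * k 2),
      ∑ p ∈ F with gap k p / (2 * k 2) = J, 1 / (gap k p : ℝ) ≤
        (if J = 0 then 320 * R else 0) + 320 * (R / k 2 + 1) := by
    intro J hJ
    rw [Finset.mem_Icc] at hJ
    rcases (F.filter (gap k · / (2 * k 2) = J)).eq_empty_or_nonempty with he | ⟨p₀, hp₀⟩
    · rw [he, Finset.sum_empty]
      split_ifs <;> positivity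
    rw [Finset.mem_filter] at hp₀
    have hle : ∀ p, gap k p / (2 * k 2) = J → 2 * k 2 * J ≤ gap k p := fun p h => by
      have := Int.ediv_mul_le (gap k p) (show 2 * k 2 ≠ 0 by omega)
      rw [h] at this
      linarith
    have hJ9 : 2 * J ≤ 9 * k 2 := by
      have h1 := hle p₀ hp₀.2
      have h2 := hgap p₀ hp₀.1
      by_contra! h
      nlinarith
    have hcard := card_window_le (F := F.filter (gap k · / (2 * k 2) = J)) hk hk0 hk1 hkR hJ.1 hJ9
      (fun p hp => hF p (Finset.mem_filter.1 hp).1) (fun p hp => (Finset.mem_filter.1 hp).2)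
    split_ifs with h0
    · subst h0
      have h1 : ∑ p ∈ F with gap k p / (2 * k 2) = 0, 1 / (gap k p : ℝ) ≤
          ((F.filter (gap k · / (2 * k 2) = 0)).card : ℝ) := by
        rw [← nsmul_one, ← Finset.sum_const]
        refine Finset.sum_le_sum fun p hp => ?_
        have : (1 : ℝ) ≤ gap k p := by exact_mod_cast hpos p (Finset.mem_filter.1 hp).1
        exact (div_le_one (by linarith)).2 this
      have h2 : 0 ≤ R / k 2 := by positivity
      simp only [Int.cast_zero, mul_zero, add_zero] at hcard
      linarith
    · have hJ1 : (1 : ℝ) ≤ J := by exact_mod_cast (show (1 : ℤ) ≤ J by omega)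
      have h1 : ∑ p ∈ F with gap k p / (2 * k 2) = J, 1 / (gap k p : ℝ) ≤
          ((F.filter (gap k · / (2 * k 2) = J)).card : ℝ) * (1 / (2 * k 2 * J)) := by
        rw [← nsmul_eq_mul, ← Finset.sum_const]
        refine Finset.sum_le_sum fun p hp => one_div_le_one_div_of_le (by positivity) ?_
        exact_mod_cast hle p (Finset.mem_filter.1 hp).2
      refine h1.trans ((mul_le_mul_of_nonneg_right hcard (by positivity)).trans ?_)
      have e : 320 * (R + k 2 * J) * (1 / (2 * k 2 * J)) = 160 * (R / k 2 / J + 1) := by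
        field_simp; ring
      have h3 : R / k 2 / J ≤ R / k 2 := div_le_self (by positivity) hJ1
      have h4 : 0 ≤ R / k 2 := by positivity
      rw [e, zero_add]
      linarith
  refine (Finset.sum_le_sum hbound).trans ?_
  have hc : ((Finset.Icc 0 (5 * k 2)).card : ℝ) = 5 * k 2 + 1 := by
    have : ((Finset.Icc 0 (5 * k 2)).card : ℤ) = 5 * k 2 + 1 := by rw [Int.card_Icc]; omega
    exact_mod_cast this
  have h0 : (0 : ℤ) ∈ Finset.Icc 0 (5 * k 2) := Finset.mem_Icc.2 ⟨le_rfl, by omega⟩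
  rw [Finset.sum_add_distrib, Finset.sum_ite_eq' , if_pos h0, Finset.sum_const, nsmul_eq_mul, hc]
  have e : (5 * (k 2 : ℝ) + 1) * (320 * (R / k 2 + 1)) =
      320 * (5 * R + 5 * k 2 + R / k 2 + 1) := by
    field_simp
    ring
  have h5 : R / k 2 ≤ R := div_le_self hR0 hn1
  rw [e]
  linarith

/-- Each line in direction `k` leaves the ball only once. -/
lemma lune_line_injective {R : ℝ} (hR : 0 ≤ R) {k p p' : Fin 3 → ℤ} (hp : p ∈ lune R k)
    (hp' : p' ∈ lune R k) {t : ℤ} (h : p' = p + t • k) : t ≤ 0 := by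
  by_contra! ht
  have h1 := (mem_lune_iff hR).1 hp
  have h2 := (mem_lune_iff hR).1 hp'
  have h3 := gap_pos hR hp
  have h4 : sqNorm p' - gap k p' = sqNorm p + (t - 1) * gap k p + t * (t - 1) * sqNorm k := by
    subst h
    simp only [sqNorm, gap, Pi.add_apply, Pi.smul_apply, smul_eq_mul]
    ring
  have h5 : 0 ≤ sqNorm k := by unfold sqNorm; positivity
  have h6 : 0 ≤ t - 1 := by omega
  have h7 : 0 ≤ (t - 1) * gap k p + t * (t - 1) * sqNorm k := by positivity
  have h8 : sqNorm p ≤ sqNorm p' - gap k p' := by linarith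
  have h9 : (sqNorm p : ℝ) ≤ sqNorm p' - gap k p' := by exact_mod_cast h8
  linarith

lemma sum_large_gap_le {R : ℝ} {k : Fin 3 → ℤ} (hR : 1 ≤ R) (hk : 0 < k 2) (hk0 : |k 0| ≤ k 2)
    (hk1 : |k 1| ≤ k 2) {F : Finset (Fin 3 → ℤ)}
    (hF : ∀ p ∈ F, p ∈ lune R k) (hgap : ∀ p ∈ F, 3 * sqNorm k < gap k p) :
    ∑ p ∈ F, 1 / (gap k p : ℝ) ≤ 40 * R := by
  classical
  have hR0 : 0 ≤ R := by linarith
  have hn1 : (1 : ℝ) ≤ k 2 := by exact_mod_cast hk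
  have hk0' : (k 0 : ℝ) ^ 2 ≤ (k 2 : ℝ) ^ 2 := by
    exact_mod_cast sq_le_sq' (abs_le.1 hk0).1 (abs_le.1 hk0).2
  have hk1' : (k 1 : ℝ) ^ 2 ≤ (k 2 : ℝ) ^ 2 := by
    exact_mod_cast sq_le_sq' (abs_le.1 hk1).1 (abs_le.1 hk1).2
  let a : (Fin 3 → ℤ) → ℤ := fun p => p 0 - p 2 / k 2 * k 0
  let b : (Fin 3 → ℤ) → ℤ := fun p => p 1 - p 2 / k 2 * k 1
  let c : (Fin 3 → ℤ) → ℤ := fun p => p 2 % k 2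
  have hc2 : ∀ p : Fin 3 → ℤ, p 2 = k 2 * (p 2 / k 2) + c p := fun p =>
    (Int.mul_ediv_add_emod (p 2) (k 2)).symm
  have hinj : ∀ p ∈ F, ∀ p' ∈ F, c p = c p' → a p = a p' → b p = b p' → p = p' := by
    intro p hp p' hp' h2 h0 h1
    have e : p' = p + (p' 2 / k 2 - p 2 / k 2) • k := by
      ext i
      simp only [Pi.add_apply, Pi.smul_apply, smul_eq_mul]
      simp only [a, b] at h0 h1
      fin_cases i <;> simp only [Fin.zero_eta, Fin.mk_one, Fin.reduceFinMk]
      · linarith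
      · linarith
      · have e1 := hc2 p
        have e2 := hc2 p'
        linarith
    have e' : p = p' + (p 2 / k 2 - p' 2 / k 2) • k := by
      rw [← neg_sub, neg_smul, ← sub_eq_add_neg]
      exact eq_sub_of_add_eq e.symm
    have h3 := lune_line_injective hR0 (hF p hp) (hF p' hp') e
    have h4 := lune_line_injective hR0 (hF p' hp') (hF p hp) e'
    have h5 : p' 2 / k 2 - p 2 / k 2 = 0 := by omega
    rw [h5, zero_smul, add_zero] at e
    exact e.symm
  set n : ℝ := ((k 2 : ℤ) : ℝ) with hn
  have hn0 : n ≠ 0 := by linarith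
  have hK : (sqNorm k : ℝ) = (k 0 : ℝ) ^ 2 + (k 1 : ℝ) ^ 2 + n ^ 2 := by
    simp only [sqNorm]; push_cast; rfl
  set K : ℝ := ((sqNorm k : ℤ) : ℝ) with hKdef
  have hKn : n ^ 2 ≤ K := by nlinarith [sq_nonneg (k 0 : ℝ), sq_nonneg (k 1 : ℝ)]
  have hK1 : 1 ≤ K := by nlinarith
  have hK0 : 0 < K := by linarith
  set E : ℝ := (k 0 : ℝ) ^ 2 + n ^ 2 with hE
  have hE0 : 0 < E := by positivity
  let u₀ : (Fin 3 → ℤ) → ℝ := fun p => a p - k 0 / n * c p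
  let u₁ : (Fin 3 → ℤ) → ℝ := fun p => b p - k 1 / n * c p
  let x : (Fin 3 → ℤ) → ℝ := fun p => u₁ p - k 0 * k 1 / E * u₀ p
  let Q : (Fin 3 → ℤ) → ℝ := fun p => E / K * x p ^ 2 + n ^ 2 / E * u₀ p ^ 2
  have hc2' : ∀ p : Fin 3 → ℤ, (p 2 : ℝ) = n * (p 2 / k 2 : ℤ) + c p := fun p => by
    rw [hn]; exact_mod_cast hc2 p
  have hu₀ : ∀ p : Fin 3 → ℤ, u₀ p = p 0 - k 0 / n * p 2 := fun p => by
    rw [hc2' p]; simp only [u₀, a]; push_cast; field_simp; ring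
  have hu₁ : ∀ p : Fin 3 → ℤ, u₁ p = p 1 - k 1 / n * p 2 := fun p => by
    rw [hc2' p]; simp only [u₁, b]; push_cast; field_simp; ring
  have hQ : ∀ p : Fin 3 → ℤ,
      K * Q p = K * sqNorm p - ((p 0 : ℝ) * k 0 + p 1 * k 1 + p 2 * n) ^ 2 := by
    intro p
    have h1 := lagrange_shear (k₀ := (k 0 : ℝ)) (k₁ := k 1) hn0 (p 0) (p 1) (p 2)
    rw [← hu₀, ← hu₁, ← hK] at h1
    have h2 : (sqNorm p : ℝ) = (p 0 : ℝ) ^ 2 + (p 1 : ℝ) ^ 2 + (p 2 : ℝ) ^ 2 := by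
      simp only [sqNorm]; push_cast; rfl
    rw [h2, h1]
    have hKE : K = E + (k 1 : ℝ) ^ 2 := by rw [hK, hE]; ring
    simp only [Q, x]
    have e : K * (E / K * (u₁ p - k 0 * k 1 / E * u₀ p) ^ 2 + n ^ 2 / E * u₀ p ^ 2)
        = E * (u₁ p - k 0 * k 1 / E * u₀ p) ^ 2 + K * n ^ 2 / E * u₀ p ^ 2 := by
      field_simp
    rw [e]
    have hn2 : n ^ 2 = E - (k 0 : ℝ) ^ 2 := by rw [hE]; ring
    rw [hn2, hKE]
    field_simp
    ring
  have hgapR : ∀ p, (gap k p : ℝ) = 2 * (p 0 * k 0 + p 1 * k 1 + p 2 * n) - K := by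
    intro p; simp only [gap, hKdef]; push_cast; rfl
  have hkey : ∀ p ∈ F, 1 ≤ R ^ 2 - Q p ∧ n * Real.sqrt (R ^ 2 - Q p) ≤ gap k p := by
    intro p hp
    have h1 := (mem_lune_iff hR0).1 (hF p hp)
    have h2 : 3 * K < gap k p := by rw [hKdef]; exact_mod_cast hgap p hp
    have h3 := hQ p
    rw [hgapR] at h1 h2 ⊢
    set s : ℝ := p 0 * k 0 + p 1 * k 1 + p 2 * n
    have h4 : 1 ≤ R ^ 2 - Q p := by
      refine le_of_mul_le_mul_left ?_ hK0
      have h5 : K * (sqNorm p - (2 * s - K)) ≤ K * R ^ 2 := mul_le_mul_of_nonneg_left h1.2 hK0.le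
      nlinarith [sq_nonneg (s - K)]
    refine ⟨h4, ?_⟩
    have h5 : n * Real.sqrt (R ^ 2 - Q p) ≤ s := by
      refine abs_le_of_sq_le_sq' ?_ (by linarith) |>.2
      rw [mul_pow, Real.sq_sqrt (by linarith)]
      have h6 : K * (R ^ 2 - Q p) ≤ s ^ 2 := by
        have : K * R ^ 2 ≤ K * sqNorm p := mul_le_mul_of_nonneg_left h1.1.le hK0.le
        linarith
      exact (mul_le_mul_of_nonneg_right hKn (by linarith)).trans h6
    linarith
  have hterm : ∀ p ∈ F, 1 / (gap k p : ℝ) ≤ 1 / n * (1 / Real.sqrt (R ^ 2 - Q p)) := by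
    intro p hp
    obtain ⟨h1, h2⟩ := hkey p hp
    have h3 : 0 < Real.sqrt (R ^ 2 - Q p) := Real.sqrt_pos.2 (by linarith)
    rw [one_div_mul_one_div]
    exact one_div_le_one_div_of_le (by positivity) h2
  refine (Finset.sum_le_sum hterm).trans ?_
  rw [← Finset.mul_sum]
  let S := F.image fun p => (c p, a p)
  have hSmem : ∀ p ∈ F, (c p, a p) ∈ S := fun p hp => Finset.mem_image_of_mem _ hp
  rw [← Finset.sum_fiberwise_of_maps_to hSmem]
  have hfiber : ∀ y ∈ S, ∑ p ∈ F with (c p, a p) = y, 1 / Real.sqrt (R ^ 2 - Q p) ≤ 8 := by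
    rintro ⟨c₀, a₀⟩ -
    have hα : 1 / 2 ≤ E / K := by
      rw [div_le_div_iff₀ (by norm_num) hK0]; linarith [sq_nonneg (k 0 : ℝ)]
    have hsplit : ∀ p ∈ F.filter (fun p => (c p, a p) = (c₀, a₀)),
        p ∈ F ∧ c p = c₀ ∧ a p = a₀ := by
      intro p hp
      simpa using hp
    have hX : ∀ p ∈ F.filter (fun p => (c p, a p) = (c₀, a₀)), R ^ 2 - Q p =
        R ^ 2 - n ^ 2 / E * ((a₀ : ℝ) - k 0 / n * c₀) ^ 2 - E / K * x p ^ 2 := by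
      intro p hp
      obtain ⟨-, h1, h2⟩ := hsplit p hp
      simp only [Q, u₀, h1, h2]
      ring
    rw [Finset.sum_congr rfl fun p hp => by rw [hX p hp]]
    refine sum_inv_sqrt_row hα ?_ fun p hp => ?_
    · intro p hp p' hp' hne
      obtain ⟨hp, h1, h2⟩ := hsplit p hp
      obtain ⟨hp', h1', h2'⟩ := hsplit p' hp'
      have hb : b p - b p' ≠ 0 := fun h =>
        hne (hinj p hp p' hp' (h1.trans h1'.symm) (h2.trans h2'.symm) (sub_eq_zero.1 h))
      have e : x p - x p' = ((b p - b p' : ℤ) : ℝ) := by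
        simp only [x, u₀, u₁, h1, h2, h1', h2']; push_cast; ring
      rw [e]
      exact_mod_cast Int.one_le_abs hb
    · rw [← hX p hp]
      exact (hkey p (hsplit p hp).1).1
  have hcard : (S.card : ℝ) ≤ n * (4 * R + 1) := by
    have hu : ∀ p ∈ F, |u₀ p| ≤ 2 * R := by
      intro p hp
      refine abs_le_of_sq_le_sq ?_ (by linarith)
      have h1 := (hkey p hp).1
      have h2 : 0 ≤ E / K * x p ^ 2 := by positivity
      have h3 : 1 / 2 * u₀ p ^ 2 ≤ n ^ 2 / E * u₀ p ^ 2 := by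
        refine mul_le_mul_of_nonneg_right ?_ (sq_nonneg _)
        rw [div_le_div_iff₀ (by norm_num) hE0]
        linarith
      simp only [Q] at h1
      nlinarith
    have h := card_le_of_rows (F := S) (x := Prod.fst) (y := Prod.snd)
      (S := Finset.Ico 0 (k 2)) (D := 4 * R) (by linarith) ?_
      (fun p _ q _ h1 h2 => Prod.ext h1 h2) ?_
    · have h2 : ((Finset.Ico 0 (k 2)).card : ℝ) = n := by
        have : ((Finset.Ico 0 (k 2)).card : ℤ) = k 2 := by rw [Int.card_Ico]; omega
        rw [hn]; exact_mod_cast this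
      rwa [h2] at h
    · intro y hy
      obtain ⟨p, -, rfl⟩ := Finset.mem_image.1 hy
      exact Finset.mem_Ico.2 ⟨Int.emod_nonneg _ hk.ne', Int.emod_lt_of_pos _ hk⟩
    · intro y hy z hz hyz
      obtain ⟨p, hp, rfl⟩ := Finset.mem_image.1 hy
      obtain ⟨p', hp', rfl⟩ := Finset.mem_image.1 hz
      have h1 := abs_le.1 (hu p hp)
      have h2 := abs_le.1 (hu p' hp')
      have h3 : c p = c p' := hyz
      simp only [u₀, h3] at h1 h2
      change (a p' : ℝ) - a p ≤ 4 * R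
      linarith [h1.1, h2.2]
  calc 1 / n * ∑ y ∈ S, ∑ p ∈ F with (c p, a p) = y, 1 / Real.sqrt (R ^ 2 - Q p)
      ≤ 1 / n * (S.card * 8) := by
        refine mul_le_mul_of_nonneg_left ?_ (by positivity)
        rw [← nsmul_eq_mul]
        exact Finset.sum_le_card_nsmul _ _ _ hfiber
    _ ≤ 1 / n * (n * (4 * R + 1) * 8) := by gcongr
    _ = 8 * (4 * R + 1) := by field_simp
    _ ≤ 40 * R := by linarith

/-! ### Reductions -/

lemma Dsum_one_le {R B : ℝ} {k : Fin 3 → ℤ} (hB : 0 ≤ B)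
    (h : ∀ F : Finset (Fin 3 → ℤ), (∀ p ∈ F, p ∈ lune R k) → ∑ p ∈ F, 1 / (gap k p : ℝ) ≤ B) :
    Dsum 1 R k ≤ B := by
  classical
  refine tsum_le_of_sum_le' hB fun F => ?_
  rw [← Finset.sum_filter]
  refine le_trans (le_of_eq ?_) (h (F.filter (· ∈ lune R k)) fun p hp => (Finset.mem_filter.1 hp).2)
  refine Finset.sum_congr (by congr) fun p _ => ?_
  rw [znorm_sq, znorm_sq, sqNorm_sub, Real.rpow_neg_one, one_div]
  push_cast
  rw [sub_sub_cancel]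

lemma znorm_neg (p : Fin 3 → ℤ) : znorm (-p) = znorm p := by
  simp [znorm]

lemma znorm_comp_perm (σ : Equiv.Perm (Fin 3)) (p : Fin 3 → ℤ) : znorm (p ∘ σ) = znorm p := by
  simp only [znorm, Function.comp_apply]
  rw [Equiv.sum_comp σ fun i => ((p i : ℝ)) ^ 2]

lemma Dsum_neg (α R : ℝ) (k : Fin 3 → ℤ) : Dsum α R (-k) = Dsum α R k := by
  classical
  unfold Dsum
  rw [← (Equiv.neg (Fin 3 → ℤ)).tsum_eq]
  refine tsum_congr fun p => ?_
  have h : -p - -k = -(p - k) := by abel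
  refine if_congr ?_ ?_ rfl <;> simp only [Equiv.neg_apply, lune, Set.mem_ofPred_eq, h, znorm_neg]

lemma Dsum_comp_perm (α R : ℝ) (σ : Equiv.Perm (Fin 3)) (k : Fin 3 → ℤ) :
    Dsum α R (k ∘ σ) = Dsum α R k := by
  classical
  unfold Dsum
  rw [← (σ.symm.arrowCongr (Equiv.refl ℤ)).tsum_eq]
  refine tsum_congr fun p => ?_
  have h1 : σ.symm.arrowCongr (Equiv.refl ℤ) p = p ∘ σ := by
    ext i; simp [Equiv.arrowCongr]
  have h2 : p ∘ σ - k ∘ σ = (p - k) ∘ σ := rfl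
  refine if_congr ?_ ?_ rfl <;> simp only [h1, lune, Set.mem_ofPred_eq, h2, znorm_comp_perm]

/-- Every lattice point can be permuted and reflected so that its last coordinate dominates. -/
lemma exists_dominant_coord (k : Fin 3 → ℤ) :
    ∃ k' : Fin 3 → ℤ, (∀ α R, Dsum α R k' = Dsum α R k) ∧ znorm k' = znorm k ∧
      |k' 0| ≤ k' 2 ∧ |k' 1| ≤ k' 2 := by
  obtain ⟨i, hi⟩ := Finite.exists_max fun i => |k i|
  have hdom : ∀ j, |(k ∘ Equiv.swap i 2) j| ≤ |(k ∘ Equiv.swap i 2) 2| := fun j => by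
    simpa using hi (Equiv.swap i 2 j)
  rcases abs_cases ((k ∘ Equiv.swap i 2) 2) with h | h
  · exact ⟨k ∘ Equiv.swap i 2, fun α R => Dsum_comp_perm α R _ k, znorm_comp_perm _ k,
      h.1 ▸ hdom 0, h.1 ▸ hdom 1⟩
  · refine ⟨-(k ∘ Equiv.swap i 2), fun α R => (Dsum_neg α R _).trans (Dsum_comp_perm α R _ k),
      (znorm_neg _).trans (znorm_comp_perm _ k), ?_, ?_⟩
    · rw [Pi.neg_apply, Pi.neg_apply, abs_neg]; exact h.1 ▸ hdom 0
    · rw [Pi.neg_apply, Pi.neg_apply, abs_neg]; exact h.1 ▸ hdom 1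

lemma sum_one_div_gap_le_cube {R : ℝ} (hR : 1 ≤ R) {k : Fin 3 → ℤ} {F : Finset (Fin 3 → ℤ)}
    (hF : ∀ p ∈ F, p ∈ lune R k) : ∑ p ∈ F, 1 / (gap k p : ℝ) ≤ 27 * R ^ 3 := by
  have hR0 : 0 ≤ R := by linarith
  have h1 : ∑ p ∈ F, 1 / (gap k p : ℝ) ≤ F.card := by
    rw [← nsmul_one, ← Finset.sum_const]
    refine Finset.sum_le_sum fun p hp => ?_
    have : (1 : ℝ) ≤ gap k p := by exact_mod_cast gap_pos hR0 (hF p hp)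
    exact (div_le_one (by linarith)).2 this
  refine h1.trans ?_
  have h2 : F.card ≤ (Fintype.piFinset fun _ : Fin 3 => Finset.Icc (-⌊R⌋) ⌊R⌋).card := by
    refine Finset.card_le_card_of_injOn (· - k) (fun p hp => ?_) (sub_left_injective.injOn)
    refine Finset.mem_coe.2 (Fintype.mem_piFinset.2 fun i => mem_Icc_floor ?_)
    have h := (hF p hp).2
    refine le_trans (Real.abs_le_sqrt ?_) h
    exact Finset.single_le_sum (f := fun i => (((p - k) i : ℤ) : ℝ) ^ 2)
      (fun _ _ => sq_nonneg _) (Finset.mem_univ i)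
  rw [Fintype.card_piFinset, Finset.prod_const, Finset.card_univ, Fintype.card_fin] at h2
  have h3 : (F.card : ℝ) ≤ ((Finset.Icc (-⌊R⌋) ⌊R⌋).card : ℝ) ^ 3 := by exact_mod_cast h2
  refine h3.trans ?_
  calc ((Finset.Icc (-⌊R⌋) ⌊R⌋).card : ℝ) ^ 3 ≤ (3 * R) ^ 3 :=
        pow_le_pow_left₀ (Nat.cast_nonneg _) ((card_Icc_floor_le hR0).trans (by linarith)) 3
    _ = 27 * R ^ 3 := by ring

lemma Dsum_one_le_linear {R : ℝ} {k : Fin 3 → ℤ} (hk : 0 < k 2) (hk0 : |k 0| ≤ k 2)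
    (hk1 : |k 1| ≤ k 2) (hkR : 100 * (k 2 : ℝ) ≤ R) : Dsum 1 R k ≤ 4040 * R := by
  have hn1 : (1 : ℝ) ≤ k 2 := by exact_mod_cast hk
  refine Dsum_one_le (by linarith) fun F hF => ?_
  rw [← Finset.sum_filter_add_sum_filter_not F (gap k · ≤ 3 * sqNorm k)]
  have h1 := sum_small_gap_le (F := F.filter (gap k · ≤ 3 * sqNorm k)) hk hk0 hk1 hkR
    (fun p hp => hF p (Finset.mem_filter.1 hp).1) (fun p hp => (Finset.mem_filter.1 hp).2)
  have h2 := sum_large_gap_le (R := R) (F := F.filter (¬ gap k · ≤ 3 * sqNorm k)) (by linarith)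
    hk hk0 hk1 (fun p hp => hF p (Finset.mem_filter.1 hp).1)
    (fun p hp => not_le.1 (Finset.mem_filter.1 hp).2)
  linarith

/-- There is `C > 0` such that for every `k_F ≥ 2` and every
`k ∈ ℤ³` with `0 < |k| < 2k_F`,
`D₁(k, k_F) ≤ C k_F (1 + (ln k_F)^{5/3} k_F^{−1/3} |k|⁴)`. -/
theorem D1_upper_bound :
    ∃ C : ℝ, 0 < C ∧ ∀ kF : ℝ, 2 ≤ kF → ∀ k : Fin 3 → ℤ,
      0 < znorm k → znorm k < 2 * kF →
      Dsum 1 kF k ≤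
        C * kF * (1 + (Real.log kF) ^ ((5 : ℝ)/3) * kF ^ (-(1 : ℝ)/3) * (znorm k) ^ 4) := by
  set ℓ : ℝ := (Real.log 2) ^ ((5 : ℝ)/3) with hℓ
  have hlog2 : 0 < Real.log 2 := Real.log_pos (by norm_num)
  have hℓ0 : 0 < ℓ := Real.rpow_pos_of_pos hlog2 _
  refine ⟨4040 + 27 * 100 ^ 4 / ℓ, by positivity, fun R hR k hk _ => ?_⟩
  obtain ⟨k', hD, hz, h0, h1⟩ := exists_dominant_coord k
  rw [← hD, ← hz]
  rw [← hz] at hk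
  have hR0 : 0 < R := by linarith
  have hlog : ℓ ≤ (Real.log R) ^ ((5 : ℝ)/3) :=
    Real.rpow_le_rpow hlog2.le (Real.log_le_log (by norm_num) hR) (by norm_num)
  have hk2 : 0 < k' 2 := by
    rcases (abs_nonneg _ |>.trans h0).lt_or_eq with h | h
    · exact h
    · rw [← h, abs_nonpos_iff] at h0 h1
      simp [znorm, Fin.sum_univ_three, h0, h1, ← h] at hk
  by_cases hc : 100 * (k' 2 : ℝ) ≤ R
  · have h2 := Dsum_one_le_linear hk2 h0 h1 hc
    have h3 : 0 ≤ 27 * 100 ^ 4 / ℓ := by positivity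
    have h4 : 0 ≤ (Real.log R) ^ ((5 : ℝ)/3) * R ^ (-(1 : ℝ)/3) * znorm k' ^ 4 := by
      have := Real.rpow_nonneg hR0.le (-(1 : ℝ)/3)
      have := hℓ0.le.trans hlog
      positivity
    calc Dsum 1 R k' ≤ 4040 * R * 1 := by linarith
      _ ≤ _ := by gcongr <;> linarith
  · push Not at hc
    have hkz : R / 100 ≤ znorm k' := by
      have : (k' 2 : ℝ) ≤ znorm k' := by
        refine Real.le_sqrt_of_sq_le ?_
        exact Finset.single_le_sum (f := fun i => ((k' i : ℤ) : ℝ) ^ 2)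
          (fun _ _ => sq_nonneg _) (Finset.mem_univ 2)
      linarith
    have hpow : R⁻¹ ≤ R ^ (-(1 : ℝ)/3) := by
      rw [← Real.rpow_neg_one]
      exact Real.rpow_le_rpow_of_exponent_le (by linarith) (by norm_num)
    have hcube : Dsum 1 R k' ≤ 27 * R ^ 3 :=
      Dsum_one_le (by positivity) fun F hF => sum_one_div_gap_le_cube (by linarith) hF
    calc Dsum 1 R k' ≤ 27 * R ^ 3 * R := by nlinarith [pow_pos hR0 3]
      _ = 27 * 100 ^ 4 / ℓ * R * (ℓ * R⁻¹ * (R / 100) ^ 4) := by field_simp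
      _ ≤ 27 * 100 ^ 4 / ℓ * R *
          ((Real.log R) ^ ((5 : ℝ)/3) * R ^ (-(1 : ℝ)/3) * znorm k' ^ 4) := by
        have := hℓ0.le.trans hlog
        have := Real.rpow_nonneg hR0.le (-(1 : ℝ)/3)
        gcongr
      _ ≤ _ := by
        have := Real.rpow_nonneg hR0.le (-(1 : ℝ)/3)
        have := hℓ0.le.trans hlog
        gcongr <;> linarith
end

section
/- There exists a constant C > 0 such that for every k_F ≥ 2, every β ≥ 0, and every function f : ℤ³ → [0, ∞), one has Σ_{k ∈ ℤ³} f(k) ⟨k⟩^{2β} D₂(k, k_F) ≤ C k_F^{2/3} (ln k_F)^{5/3} Σ_{k ∈ ℤ³} f(k) ⟨k⟩^{2β + 4} (the inequality being trivially true when the right-hand side is infinite). In particular, taking f(k) = |V̂(k)|², one has S_{2,β}(k_F) ≤ C ‖V‖²_{H^{2+β}} k_F^{2/3} (ln k_F)^{5/3}. -/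
open scoped BigOperators

open scoped ENNReal

/-- The Japanese bracket `⟨k⟩ = (1 + |k|²)^{1/2}`. -/
noncomputable def jap (k : Fin 3 → ℤ) : ℝ := Real.sqrt (1 + (znorm k) ^ 2)

namespace LatticeCircle

/-- For three points on a circle of radius `√r`, the relation `abc = 4ρ · Area` between the side
lengths, the circumradius and the area, in squared form. -/
lemma circumradius_identity {a b c : ℂ} {r : ℝ} (ha : Complex.normSq a = r)
    (hb : Complex.normSq b = r) (hc : Complex.normSq c = r) :
    Complex.normSq (a - b) * Complex.normSq (a - c) * Complex.normSq (b - c) =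
      r * (4 * Complex.normSq (a - b) * Complex.normSq (a - c) -
        (Complex.normSq (a - b) + Complex.normSq (a - c) - Complex.normSq (b - c)) ^ 2) := by
  simp only [Complex.normSq_apply, Complex.sub_re, Complex.sub_im] at *
  obtain ⟨x, hx⟩ : ∃ x, x = a.re * b.re + a.im * b.im := ⟨_, rfl⟩
  obtain ⟨y, hy⟩ : ∃ y, y = a.re * c.re + a.im * c.im := ⟨_, rfl⟩
  obtain ⟨w, hw⟩ : ∃ w, w = b.re * c.re + b.im * c.im := ⟨_, rfl⟩
  have gram : r * r * r + 2 * x * y * w - r * (x ^ 2 + y ^ 2 + w ^ 2) = 0 := by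
    have : (a.re * a.re + a.im * a.im) * (b.re * b.re + b.im * b.im) *
        (c.re * c.re + c.im * c.im) + 2 * x * y * w - ((c.re * c.re + c.im * c.im) * x ^ 2 +
        (b.re * b.re + b.im * b.im) * y ^ 2 + (a.re * a.re + a.im * a.im) * w ^ 2) = 0 := by
      subst hx hy hw; ring
    rw [ha, hb, hc] at this
    linear_combination this
  have hab : (a.re - b.re) * (a.re - b.re) + (a.im - b.im) * (a.im - b.im) = 2 * (r - x) := by
    linear_combination ha + hb + 2 * hx
  have hac : (a.re - c.re) * (a.re - c.re) + (a.im - c.im) * (a.im - c.im) = 2 * (r - y) := by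
    linear_combination ha + hc + 2 * hy
  have hbc : (b.re - c.re) * (b.re - c.re) + (b.im - c.im) * (b.im - c.im) = 2 * (r - w) := by
    linear_combination hb + hc + 2 * hw
  rw [hab, hac, hbc]
  linear_combination (-4) * gram

/-- On a circle, chords are no longer than arcs. -/
lemma norm_sub_le_of_norm_eq {a b : ℂ} {ρ : ℝ} (ha : ‖a‖ = ρ) (hb : ‖b‖ = ρ) :
    ‖a - b‖ ≤ ρ * |a.arg - b.arg| := by
  have h : a - b = ρ * Complex.exp (Complex.I * b.arg) *
      (Complex.exp (Complex.I * ((a.arg - b.arg : ℝ) : ℂ)) - 1) := by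
    have e : Complex.exp (Complex.I * b.arg) * Complex.exp (Complex.I * ((a.arg - b.arg : ℝ) : ℂ)) =
        Complex.exp (a.arg * Complex.I) := by
      rw [← Complex.exp_add]; push_cast; ring_nf
    have ha' := Complex.norm_mul_exp_arg_mul_I a
    have hb' := Complex.norm_mul_exp_arg_mul_I b
    rw [ha] at ha'
    rw [hb] at hb'
    rw [mul_sub, mul_assoc, e, ha', mul_one, mul_comm Complex.I, hb']
  have hρ : 0 ≤ ρ := ha ▸ norm_nonneg a
  rw [h, norm_mul, norm_mul, mul_comm Complex.I, Complex.norm_exp_ofReal_mul_I, mul_one,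
    Complex.norm_real, Real.norm_of_nonneg hρ]
  exact mul_le_mul_of_nonneg_left Real.norm_exp_I_mul_ofReal_sub_one_le hρ

/-- Distinct points on a circle of radius `ρ` whose mutual squared distances are integers:
at most two of them lie on an arc much shorter than `ρ ^ (1 / 3)`. -/
lemma card_le_of_integral_dist {ι : Type*} (S : Finset ι) (z : ι → ℂ) {ρ : ℝ}
    (hz : ∀ p ∈ S, ‖z p‖ = ρ)
    (hint : ∀ p ∈ S, ∀ q ∈ S, p ≠ q → ∃ n : ℤ, n ≠ 0 ∧ Complex.normSq (z p - z q) = n)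
    {M : ℕ} (hM0 : 0 < M) (hM : (2 * Real.pi) ^ 6 * ρ ^ 4 < (M : ℝ) ^ 6) :
    S.card ≤ (M + 1) * 2 := by
  classical
  by_contra! hcard
  have hMpos : (0 : ℝ) < M := by exact_mod_cast hM0
  have hpi := Real.pi_pos
  let g : ι → ℕ := fun p => ⌊((z p).arg + Real.pi) * (M / (2 * Real.pi))⌋₊
  have hnn : ∀ p, 0 ≤ ((z p).arg + Real.pi) * (M / (2 * Real.pi)) := fun p =>
    mul_nonneg (by linarith [Complex.neg_pi_lt_arg (z p)]) (by positivity)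
  have hmaps : ∀ p ∈ S, g p ∈ Finset.range (M + 1) := by
    intro p _
    rw [Finset.mem_range, Nat.lt_succ_iff]
    have : ((z p).arg + Real.pi) * (M / (2 * Real.pi)) ≤ M := by
      calc ((z p).arg + Real.pi) * (M / (2 * Real.pi))
          ≤ (2 * Real.pi) * (M / (2 * Real.pi)) := by
            gcongr
            linarith [Complex.arg_le_pi (z p)]
        _ = M := by field_simp
    exact Nat.floor_le_of_le this
  obtain ⟨y, -, hy⟩ := Finset.exists_lt_card_fiber_of_mul_lt_card_of_maps_to hmaps
    (by simpa using hcard)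
  obtain ⟨p, hp, q, hq, s, hs, hpq, hps, hqs⟩ := Finset.two_lt_card.1 hy
  rw [Finset.mem_filter] at hp hq hs
  have close : ∀ p ∈ S, ∀ q ∈ S, g p = g q →
      Complex.normSq (z p - z q) ≤ (ρ * (2 * Real.pi / M)) ^ 2 := by
    intro p hp q hq hg
    rw [Complex.normSq_eq_norm_sq]
    have hρ : 0 ≤ ρ := hz p hp ▸ norm_nonneg _
    have harg : |(z p).arg - (z q).arg| ≤ 2 * Real.pi / M := by
      have h1 := Nat.floor_le (hnn p)
      have h2 := Nat.lt_floor_add_one (((z p).arg + Real.pi) * (M / (2 * Real.pi)))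
      have h3 := Nat.floor_le (hnn q)
      have h4 := Nat.lt_floor_add_one (((z q).arg + Real.pi) * (M / (2 * Real.pi)))
      have hg' : (⌊((z p).arg + Real.pi) * (M / (2 * Real.pi))⌋₊ : ℝ) =
          ⌊((z q).arg + Real.pi) * (M / (2 * Real.pi))⌋₊ := by exact_mod_cast hg
      have h5 : |((z p).arg - (z q).arg) * (M / (2 * Real.pi))| ≤ 1 := by
        rw [abs_le]; constructor <;> linarith
      rw [abs_mul, abs_of_pos (show 0 < (M : ℝ) / (2 * Real.pi) by positivity)] at h5
      rwa [← le_div_iff₀ (by positivity), one_div_div] at h5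
    exact pow_le_pow_left₀ (norm_nonneg _)
      ((norm_sub_le_of_norm_eq (hz p hp) (hz q hq)).trans (by gcongr)) 2
  have hsq : ∀ p ∈ S, Complex.normSq (z p) = ρ ^ 2 := fun p hp => by
    rw [Complex.normSq_eq_norm_sq, hz p hp]
  have key := circumradius_identity (hsq p hp.1) (hsq q hq.1) (hsq s hs.1)
  have c1 := close p hp.1 q hq.1 (hp.2.trans hq.2.symm)
  have c2 := close p hp.1 s hs.1 (hp.2.trans hs.2.symm)
  have c3 := close q hq.1 s hs.1 (hq.2.trans hs.2.symm)
  have n1 := Complex.normSq_nonneg (z p - z q)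
  have n2 := Complex.normSq_nonneg (z p - z s)
  have n3 := Complex.normSq_nonneg (z q - z s)
  obtain ⟨A, hA, hA'⟩ := hint p hp.1 q hq.1 hpq
  obtain ⟨B, hB, hB'⟩ := hint p hp.1 s hs.1 hps
  obtain ⟨C, hC, hC'⟩ := hint q hq.1 s hs.1 hqs
  have prod_le : Complex.normSq (z p - z q) * Complex.normSq (z p - z s) *
      Complex.normSq (z q - z s) ≤ (ρ * (2 * Real.pi / M)) ^ 6 := by
    calc _ ≤ (ρ * (2 * Real.pi / M)) ^ 2 * (ρ * (2 * Real.pi / M)) ^ 2 *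
          (ρ * (2 * Real.pi / M)) ^ 2 := by gcongr
      _ = _ := by ring
  rw [hA', hB', hC'] at key prod_le
  rw [hA'] at n1
  rw [hB'] at n2
  rw [hC'] at n3
  have hpos : (0 : ℝ) < A * B * C := by
    have h1 : (A : ℝ) ≠ 0 := by exact_mod_cast hA
    have h2 : (B : ℝ) ≠ 0 := by exact_mod_cast hB
    have h3 : (C : ℝ) ≠ 0 := by exact_mod_cast hC
    positivity
  have hρ2 : 0 < ρ ^ 2 := by
    rcases (sq_nonneg ρ).lt_or_eq with h | h
    · exact h
    · rw [← h, zero_mul] at key; linarith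
  have harea : (1 : ℝ) ≤ 4 * A * B - (A + B - C) ^ 2 := by
    have : (0 : ℝ) < 4 * A * B - (A + B - C) ^ 2 := by
      rw [key] at hpos
      exact pos_of_mul_pos_right hpos hρ2.le
    have : (0 : ℤ) < 4 * A * B - (A + B - C) ^ 2 := by exact_mod_cast this
    exact_mod_cast this
  have h1 : ρ ^ 2 ≤ (ρ * (2 * Real.pi / M)) ^ 6 := by
    refine le_trans ?_ prod_le
    rw [key]
    exact le_mul_of_one_le_right hρ2.le harea
  have h2 : (ρ * (2 * Real.pi / M)) ^ 6 = ρ ^ 2 * ((2 * Real.pi) ^ 6 * ρ ^ 4 / M ^ 6) := by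
    field_simp
  rw [h2] at h1
  have h3 : (2 * Real.pi) ^ 6 * ρ ^ 4 / M ^ 6 < 1 := by
    rwa [div_lt_one (by positivity)]
  nlinarith

/-- Isometric linear coordinates on the plane orthogonal to `k`. -/
lemma exists_plane_coordinates {k : Fin 3 → ℝ} (hk : k ≠ 0) :
    ∃ e f : Fin 3 → ℝ, ∀ d : Fin 3 → ℝ, ∑ i, d i * k i = 0 →
      (∑ i, e i * d i) ^ 2 + (∑ i, f i * d i) ^ 2 = ∑ i, d i ^ 2 := by
  simp only [Fin.sum_univ_three]
  rcases (add_nonneg (sq_nonneg (k 0)) (sq_nonneg (k 1))).lt_or_eq with hs | hs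
  · obtain ⟨s, hsd⟩ : ∃ s, s = k 0 ^ 2 + k 1 ^ 2 := ⟨_, rfl⟩
    rw [← hsd] at hs
    have hn : 0 < s + k 2 ^ 2 := by positivity
    refine ⟨![-k 1 / √s, k 0 / √s, 0], ![k 0 * k 2 / √(s * (s + k 2 ^ 2)),
      k 1 * k 2 / √(s * (s + k 2 ^ 2)), -s / √(s * (s + k 2 ^ 2))], fun d hd => ?_⟩
    simp only [Matrix.cons_val]
    have h1 : (-k 1 / √s * d 0 + k 0 / √s * d 1 + 0 * d 2) ^ 2 =
        (-k 1 * d 0 + k 0 * d 1) ^ 2 / s := by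
      nth_rw 3 [← Real.sq_sqrt hs.le]
      ring
    have h2 : (k 0 * k 2 / √(s * (s + k 2 ^ 2)) * d 0 + k 1 * k 2 / √(s * (s + k 2 ^ 2)) * d 1 +
        -s / √(s * (s + k 2 ^ 2)) * d 2) ^ 2 =
        (k 0 * k 2 * d 0 + k 1 * k 2 * d 1 - s * d 2) ^ 2 / (s * (s + k 2 ^ 2)) := by
      rw [← Real.sq_sqrt (mul_pos hs hn).le, Real.sqrt_sq (Real.sqrt_nonneg _)]
      ring
    rw [h1, h2]
    have h3 : k 0 * k 2 * d 0 + k 1 * k 2 * d 1 - s * d 2 = -(s + k 2 ^ 2) * d 2 := by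
      linear_combination k 2 * hd
    have h4 : (-k 1 * d 0 + k 0 * d 1) ^ 2 = s * (d 0 ^ 2 + d 1 ^ 2) - (d 2 * k 2) ^ 2 := by
      rw [hsd]
      linear_combination (-(d 0 * k 0 + d 1 * k 1) + d 2 * k 2) * hd
    rw [h3, h4]
    field_simp
    ring
  · have h0 : k 0 = 0 := by nlinarith [sq_nonneg (k 0), sq_nonneg (k 1)]
    have h1 : k 1 = 0 := by nlinarith [sq_nonneg (k 0), sq_nonneg (k 1)]
    have h2 : k 2 ≠ 0 := by
      intro h2
      exact hk (by ext i; fin_cases i <;> simp [h0, h1, h2])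
    refine ⟨![1, 0, 0], ![0, 1, 0], fun d hd => ?_⟩
    have : d 2 = 0 := by simpa [h0, h1, h2] using hd
    simp [this]

/-- A circle contained in the sphere of radius `√N` has `O(N ^ (1 / 3))` lattice points. -/
lemma card_le_of_sphere_inter_plane {k : Fin 3 → ℤ} (hk : k ≠ 0) {t N X : ℝ}
    (hX : 0 ≤ X) (hNX : N ≤ X) (S : Finset (Fin 3 → ℤ))
    (hS : ∀ p ∈ S, ∑ i, (p i : ℝ) * k i = t ∧ ∑ i, (p i : ℝ) ^ 2 = N) :
    (S.card : ℝ) ≤ 14 * X ^ ((1 : ℝ) / 3) + 4 := by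
  have hk' : (fun i => (k i : ℝ)) ≠ 0 := by
    intro h
    exact hk (by ext i; simpa using congrFun h i)
  obtain ⟨e, f, hef⟩ := exists_plane_coordinates hk'
  have hn : 0 < ∑ i, (k i : ℝ) ^ 2 := by
    obtain ⟨i, hi⟩ := Function.ne_iff.1 hk
    have hi' : (k i : ℝ) ≠ 0 := by exact_mod_cast hi
    exact Finset.sum_pos' (fun i _ => sq_nonneg _) ⟨i, Finset.mem_univ i, by positivity⟩
  obtain ⟨n, hnd⟩ : ∃ n, n = ∑ i, (k i : ℝ) ^ 2 := ⟨_, rfl⟩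
  rw [← hnd] at hn
  let z : (Fin 3 → ℤ) → ℂ := fun p =>
    ⟨∑ i, e i * (p i - t / n * k i), ∑ i, f i * (p i - t / n * k i)⟩
  have hz : ∀ p ∈ S, Complex.normSq (z p) = N - t ^ 2 / n := by
    intro p hp
    obtain ⟨h1, h2⟩ := hS p hp
    have h3 := hef (fun i => p i - t / n * k i) (by
      simp only [Fin.sum_univ_three] at *
      have : t / n * n = t := by field_simp
      linear_combination h1 - this - t / n * (-hnd))
    rw [Complex.normSq_apply, ← sq, ← sq, h3]
    simp only [Fin.sum_univ_three] at *
    have : t ^ 2 / n = t / n * t := by ring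
    rw [this]
    have : t / n * n = t := by field_simp
    linear_combination h2 - 2 * (t / n) * h1 + t / n * this - (t / n) ^ 2 * hnd
  rcases S.eq_empty_or_nonempty with rfl | ⟨p₀, hp₀⟩
  · simp; positivity
  obtain ⟨ρ, hρ⟩ : ∃ ρ, ρ = ‖z p₀‖ := ⟨_, rfl⟩
  have hρ0 : 0 ≤ ρ := hρ ▸ norm_nonneg _
  have hρ2 : ρ ^ 2 = N - t ^ 2 / n := by rw [hρ, ← Complex.normSq_eq_norm_sq, hz p₀ hp₀]
  have hzρ : ∀ p ∈ S, ‖z p‖ = ρ := by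
    intro p hp
    have := hz p hp
    rw [← hρ2, Complex.normSq_eq_norm_sq] at this
    exact (pow_left_inj₀ (norm_nonneg _) hρ0 two_ne_zero).1 this
  have hint : ∀ p ∈ S, ∀ q ∈ S, p ≠ q → ∃ m : ℤ, m ≠ 0 ∧ Complex.normSq (z p - z q) = m := by
    intro p hp q hq hpq
    refine ⟨∑ i, (p i - q i) ^ 2, ?_, ?_⟩
    · intro h0
      rw [Finset.sum_eq_zero_iff_of_nonneg (fun i _ => sq_nonneg _)] at h0
      exact hpq (by ext i; have := h0 i (Finset.mem_univ i); simpa [sub_eq_zero] using this)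
    · have h1 := (hS p hp).1
      have h2 := (hS q hq).1
      have h3 := hef (fun i => p i - q i) (by
        simp only [Fin.sum_univ_three] at *
        linear_combination h1 - h2)
      push_cast
      rw [← h3, Complex.normSq_apply, Complex.sub_re, Complex.sub_im]
      simp only [Fin.sum_univ_three, z]
      ring
  obtain ⟨Y, hYd⟩ : ∃ Y, Y = X ^ ((1 : ℝ) / 3) := ⟨_, rfl⟩
  have hY0 : 0 ≤ Y := hYd ▸ Real.rpow_nonneg hX _
  have hY3 : Y ^ 3 = X := by
    rw [hYd, ← Real.rpow_natCast, ← Real.rpow_mul hX]; norm_num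
  have hM : (2 * Real.pi) ^ 6 * ρ ^ 4 < ((⌊7 * Y⌋₊ + 1 : ℕ) : ℝ) ^ 6 := by
    have h1 : ρ ^ 2 ≤ Y ^ 3 := by
      rw [hρ2, hY3]
      have : 0 ≤ t ^ 2 / n := by positivity
      linarith
    have h2 : ρ ^ 4 ≤ Y ^ 6 := by
      calc ρ ^ 4 = (ρ ^ 2) ^ 2 := by ring
        _ ≤ (Y ^ 3) ^ 2 := by gcongr
        _ = Y ^ 6 := by ring
    have h3 : 2 * Real.pi ≤ 7 := by linarith [Real.pi_lt_d2]
    calc (2 * Real.pi) ^ 6 * ρ ^ 4 ≤ 7 ^ 6 * Y ^ 6 := by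
          have := Real.pi_pos
          gcongr
      _ = (7 * Y) ^ 6 := by ring
      _ < _ := by
          refine pow_lt_pow_left₀ ?_ (by positivity) (by norm_num)
          push_cast
          exact Nat.lt_floor_add_one _
  have hcard := card_le_of_integral_dist S z hzρ hint (Nat.succ_pos _) hM
  have hfl := Nat.floor_le (show 0 ≤ 7 * Y by positivity)
  have hcard' : (S.card : ℝ) ≤ ((⌊7 * Y⌋₊ : ℝ) + 1 + 1) * 2 := by exact_mod_cast hcard
  rw [← hYd]
  linarith

lemma znorm_nonneg (k : Fin 3 → ℤ) : 0 ≤ znorm k := Real.sqrt_nonneg _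

lemma znorm_sq (k : Fin 3 → ℤ) : znorm k ^ 2 = ∑ i, (k i : ℝ) ^ 2 :=
  Real.sq_sqrt (Finset.sum_nonneg fun _ _ => sq_nonneg _)

lemma znorm_eq_norm (k : Fin 3 → ℤ) :
    znorm k = ‖(WithLp.toLp 2 fun i => (k i : ℝ) : EuclideanSpace ℝ (Fin 3))‖ := by
  simp [znorm, EuclideanSpace.norm_eq]

lemma znorm_le_znorm_sub_add (p k : Fin 3 → ℤ) : znorm p ≤ znorm (p - k) + znorm k := by
  simp only [znorm_eq_norm]
  refine le_trans (le_of_eq ?_) (norm_add_le _ _)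
  congr 1
  ext i
  simp

lemma one_le_jap (k : Fin 3 → ℤ) : 1 ≤ jap k :=
  Real.one_le_sqrt.2 (by linarith [sq_nonneg (znorm k)])

lemma znorm_le_jap (k : Fin 3 → ℤ) : znorm k ≤ jap k :=
  Real.le_sqrt_of_sq_le (by linarith)

/-- The integer `|p|²`. -/
def intNormSq (p : Fin 3 → ℤ) : ℤ := ∑ i, p i ^ 2

lemma intNormSq_cast (p : Fin 3 → ℤ) : (intNormSq p : ℝ) = znorm p ^ 2 := by
  rw [znorm_sq, intNormSq]; push_cast; rfl

/-- The lune is sliced by the planes on which the gap `|p|² - |p - k|²` equals `m`; each slice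
lies on `m` concentric circles. -/
lemma card_lune_slice_le {kF : ℝ} {k : Fin 3 → ℤ} (hk : k ≠ 0) {X : ℝ} (hX : 0 ≤ X)
    (S : Finset (Fin 3 → ℤ)) (hS : ∀ p ∈ S, p ∈ lune kF k) (hSX : ∀ p ∈ S, znorm p ^ 2 ≤ X)
    (hkF : 0 ≤ kF) (m : ℕ) (hm : ∀ p ∈ S, intNormSq p - intNormSq (p - k) = m) :
    (S.card : ℝ) ≤ m * (14 * X ^ ((1 : ℝ) / 3) + 4) := by
  classical
  have hmaps : ∀ p ∈ S, intNormSq p ∈ Finset.Ioc ⌊kF ^ 2⌋ (⌊kF ^ 2⌋ + m) := by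
    intro p hp
    obtain ⟨h1, h2⟩ := hS p hp
    rw [Finset.mem_Ioc, Int.floor_lt, ← sub_le_iff_le_add, Int.le_floor, ← hm p hp, sub_sub_cancel,
      intNormSq_cast, intNormSq_cast]
    exact ⟨by gcongr, pow_le_pow_left₀ (znorm_nonneg _) h2 2⟩
  rw [Finset.card_eq_sum_card_fiberwise hmaps]
  push_cast
  have hfib : ∀ N ∈ Finset.Ioc ⌊kF ^ 2⌋ (⌊kF ^ 2⌋ + (m : ℤ)),
      ((S.filter fun p => intNormSq p = N).card : ℝ) ≤ 14 * X ^ ((1 : ℝ) / 3) + 4 := by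
    intro N _
    rcases (S.filter fun p => intNormSq p = N).eq_empty_or_nonempty with h | ⟨p₀, hp₀⟩
    · rw [h]; simp; positivity
    rw [Finset.mem_filter] at hp₀
    refine card_le_of_sphere_inter_plane hk (t := (m + znorm k ^ 2) / 2) (N := N) hX ?_ _ ?_
    · rw [← hp₀.2, intNormSq_cast]; exact hSX _ hp₀.1
    · intro p hp
      rw [Finset.mem_filter] at hp
      have h1 : ((intNormSq p - intNormSq (p - k) : ℤ) : ℝ) = m := by
        rw [hm p hp.1, Int.cast_natCast]
      rw [← hp.2, intNormSq_cast, znorm_sq, znorm_sq]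
      rw [Int.cast_sub, intNormSq_cast, intNormSq_cast, znorm_sq, znorm_sq] at h1
      simp only [Fin.sum_univ_three, Pi.sub_apply] at *
      push_cast at h1
      refine ⟨?_, trivial⟩
      linear_combination h1 / 2
  refine (Finset.sum_le_sum hfib).trans (le_of_eq ?_)
  rw [Finset.sum_const, Int.card_Ioc, add_sub_cancel_left, Int.toNat_natCast, nsmul_eq_mul]

lemma Dsum_zero (kF : ℝ) : Dsum 2 kF 0 = 0 := by
  have h : lune kF 0 = ∅ := by
    ext p
    simp [lune]
  simp [Dsum, h]

lemma Dsum_two_le_harmonic {kF : ℝ} (hkF : 2 ≤ kF) {k : Fin 3 → ℤ} (hk : k ≠ 0) :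
    Dsum 2 kF k ≤ (14 * (4 * kF ^ 2 * jap k ^ 2) ^ ((1 : ℝ) / 3) + 4) *
      (1 + Real.log (4 * kF ^ 2 * jap k ^ 2)) := by
  classical
  obtain ⟨X, hXd⟩ : ∃ X, X = 4 * kF ^ 2 * jap k ^ 2 := ⟨_, rfl⟩
  have hJ := one_le_jap k
  have hX1 : 1 ≤ X := by
    rw [hXd]
    nlinarith [one_le_pow₀ hJ (n := 2), one_le_pow₀ (show 1 ≤ kF by linarith) (n := 2)]
  have hX0 : 0 ≤ X := by linarith
  rw [← hXd]
  have hsq : ∀ p ∈ lune kF k, znorm p ^ 2 ≤ X := by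
    rintro p ⟨-, h2⟩
    have h3 : znorm p ≤ 2 * kF * jap k := by
      nlinarith [znorm_le_znorm_sub_add p k, znorm_le_jap k]
    calc znorm p ^ 2 ≤ (2 * kF * jap k) ^ 2 := pow_le_pow_left₀ (znorm_nonneg _) h3 2
      _ = X := by rw [hXd]; ring
  have hgap : ∀ p ∈ lune kF k, 0 < intNormSq p - intNormSq (p - k) := by
    rintro p ⟨h1, h2⟩
    have : (0 : ℝ) < ((intNormSq p - intNormSq (p - k) : ℤ) : ℝ) := by
      rw [Int.cast_sub, intNormSq_cast, intNormSq_cast, sub_pos]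
      exact pow_lt_pow_left₀ (h2.trans_lt h1) (znorm_nonneg _) two_ne_zero
    exact_mod_cast this
  have hB : 0 ≤ 14 * X ^ ((1 : ℝ) / 3) + 4 := by positivity
  have hlog : 0 ≤ Real.log X := Real.log_nonneg hX1
  let gap : (Fin 3 → ℤ) → ℕ := fun p => (intNormSq p - intNormSq (p - k)).toNat
  have gap_cast : ∀ p ∈ lune kF k, ((gap p : ℕ) : ℤ) = intNormSq p - intNormSq (p - k) :=
    fun p hp => Int.toNat_of_nonneg (hgap p hp).le
  have gap_real : ∀ p ∈ lune kF k, (gap p : ℝ) = znorm p ^ 2 - znorm (p - k) ^ 2 := by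
    intro p hp
    rw [← intNormSq_cast, ← intNormSq_cast, ← Int.cast_sub, ← gap_cast p hp, Int.cast_natCast]
  refine Real.tsum_le_of_sum_le (fun p => ?_) (fun s => ?_)
  · split_ifs with hp
    · rw [← gap_real p hp]; positivity
    · exact le_rfl
  rw [← Finset.sum_filter]
  obtain ⟨S, hSd⟩ : ∃ S, S = s.filter (fun p => p ∈ lune kF k) := ⟨_, rfl⟩
  rw [← hSd]
  have hS : ∀ p ∈ S, p ∈ lune kF k := fun p hp => (Finset.mem_filter.1 (hSd ▸ hp)).2
  have hmaps : ∀ p ∈ S, gap p ∈ Finset.Icc 1 ⌊X⌋₊ := by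
    intro p hp
    rw [Finset.mem_Icc]
    constructor
    · have h1 := gap_cast p (hS p hp)
      have h2 := hgap p (hS p hp)
      omega
    · refine Nat.le_floor ?_
      rw [gap_real p (hS p hp)]
      linarith [hsq p (hS p hp), sq_nonneg (znorm (p - k))]
  rw [← Finset.sum_fiberwise_of_maps_to hmaps]
  have hfib : ∀ m ∈ Finset.Icc 1 ⌊X⌋₊,
      ∑ p ∈ S with gap p = m, (znorm p ^ 2 - znorm (p - k) ^ 2) ^ (-2 : ℝ) ≤
        (14 * X ^ ((1 : ℝ) / 3) + 4) * (m : ℝ)⁻¹ := by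
    intro m hm
    have hm0 : (0 : ℝ) < m := by exact_mod_cast (Finset.mem_Icc.1 hm).1
    have hc : ((S.filter fun p => gap p = m).card : ℝ) ≤ m * (14 * X ^ ((1 : ℝ) / 3) + 4) := by
      refine card_lune_slice_le hk hX0 _ (fun p hp => hS p (Finset.mem_filter.1 hp).1)
        (fun p hp => hsq p (hS p (Finset.mem_filter.1 hp).1)) (by linarith) m (fun p hp => ?_)
      rw [Finset.mem_filter] at hp
      rw [← gap_cast p (hS p hp.1), hp.2]
    have hterm : ∀ p ∈ S.filter (fun p => gap p = m),
        (znorm p ^ 2 - znorm (p - k) ^ 2) ^ (-2 : ℝ) = ((m : ℝ) ^ 2)⁻¹ := by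
      intro p hp
      rw [Finset.mem_filter] at hp
      rw [← gap_real p (hS p hp.1), hp.2, Real.rpow_neg hm0.le, Real.rpow_two]
    rw [Finset.sum_congr rfl hterm, Finset.sum_const, nsmul_eq_mul]
    calc _ ≤ m * (14 * X ^ ((1 : ℝ) / 3) + 4) * ((m : ℝ) ^ 2)⁻¹ := by gcongr
      _ = _ := by field_simp
  refine (Finset.sum_le_sum hfib).trans ?_
  rw [← Finset.mul_sum]
  refine mul_le_mul_of_nonneg_left ?_ hB
  have hh := harmonic_floor_le_one_add_log X hX1
  rw [harmonic_eq_sum_Icc] at hh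
  push_cast at hh
  exact hh

lemma Dsum_two_le {kF : ℝ} (hkF : 2 ≤ kF) (k : Fin 3 → ℤ) :
    Dsum 2 kF k ≤ 800 * kF ^ ((2 : ℝ) / 3) * Real.log kF ^ ((5 : ℝ) / 3) * jap k ^ (4 : ℝ) := by
  have hL : 0.69 ≤ Real.log kF := by
    have := Real.log_le_log (by norm_num) hkF
    linarith [Real.log_two_gt_d9]
  have hJ := one_le_jap k
  rcases eq_or_ne k 0 with rfl | hk
  · rw [Dsum_zero]; positivity
  refine (Dsum_two_le_harmonic hkF hk).trans ?_
  obtain ⟨L, hLd⟩ : ∃ L, L = Real.log kF := ⟨_, rfl⟩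
  obtain ⟨J, hJd⟩ : ∃ J, J = jap k := ⟨_, rfl⟩
  obtain ⟨Y, hYd⟩ : ∃ Y, Y = kF ^ ((2 : ℝ) / 3) := ⟨_, rfl⟩
  rw [← hLd] at hL ⊢
  rw [← hJd] at hJ ⊢
  rw [← hYd]
  have hY : 1 ≤ Y := hYd ▸ Real.one_le_rpow (by linarith) (by norm_num)
  have hpow : (4 * kF ^ 2 * J ^ 2) ^ ((1 : ℝ) / 3) ≤ 2 * Y * J := by
    have h1 : Y ^ 3 = kF ^ 2 := by
      rw [hYd, ← Real.rpow_natCast, ← Real.rpow_mul (by linarith), ← Real.rpow_natCast]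
      norm_num
    rw [← h1]
    have h2 : 4 * Y ^ 3 * J ^ 2 ≤ (2 * Y * J) ^ 3 := by
      have : J ^ 2 ≤ J ^ 3 := pow_le_pow_right₀ hJ (by norm_num)
      have hY3 : 0 ≤ Y ^ 3 := by positivity
      have := mul_le_mul_of_nonneg_left this hY3
      have : 0 ≤ Y ^ 3 * J ^ 3 := by positivity
      nlinarith
    calc _ ≤ ((2 * Y * J) ^ 3) ^ ((1 : ℝ) / 3) := by gcongr
      _ = 2 * Y * J := by
        rw [← Real.rpow_natCast, ← Real.rpow_mul (by positivity)]; norm_num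
  have hlog : 1 + Real.log (4 * kF ^ 2 * J ^ 2) ≤ 10 * L * J := by
    have h4 : Real.log 4 ≤ 2 * L := by
      rw [show (4 : ℝ) = 2 ^ 2 by norm_num, Real.log_pow, hLd]
      have := Real.log_le_log (by norm_num) hkF
      push_cast; linarith
    rw [Real.log_mul (by positivity) (by positivity), Real.log_mul (by norm_num) (by positivity),
      Real.log_pow, Real.log_pow, ← hLd]
    have := Real.log_le_sub_one_of_pos (show 0 < J by linarith)
    push_cast
    nlinarith
  have hL53 : L ≤ 2 * L ^ ((5 : ℝ) / 3) := by
    have hL0 : 0 < L := by linarith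
    have h1 : 0.5 ≤ L ^ ((2 : ℝ) / 3) := by
      rcases le_total 1 L with h | h
      · have := Real.one_le_rpow h (show (0 : ℝ) ≤ 2 / 3 by norm_num)
        linarith
      · have := Real.rpow_le_rpow_of_exponent_ge hL0 h (show (2 : ℝ) / 3 ≤ 1 by norm_num)
        rw [Real.rpow_one] at this
        linarith
    rw [show (5 : ℝ) / 3 = 1 + 2 / 3 by norm_num, Real.rpow_add hL0, Real.rpow_one]
    nlinarith
  have hJ4 : J ^ 2 ≤ J ^ (4 : ℝ) := by
    rw [show (4 : ℝ) = ((4 : ℕ) : ℝ) by norm_num, Real.rpow_natCast]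
    exact pow_le_pow_right₀ hJ (by norm_num)
  have hbase : 14 * (4 * kF ^ 2 * J ^ 2) ^ ((1 : ℝ) / 3) + 4 ≤ 32 * Y * J := by nlinarith
  calc _ ≤ (32 * Y * J) * (10 * L * J) := by
        have : 0 ≤ (4 * kF ^ 2 * J ^ 2) ^ ((1 : ℝ) / 3) := by positivity
        refine mul_le_mul hbase hlog ?_ (by positivity)
        have : 0 ≤ Real.log (4 * kF ^ 2 * J ^ 2) := by
          refine Real.log_nonneg ?_
          nlinarith [one_le_pow₀ hJ (n := 2), one_le_pow₀ (show 1 ≤ kF by linarith) (n := 2)]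
        linarith
    _ = 320 * Y * L * J ^ 2 := by ring
    _ ≤ 320 * Y * (2 * L ^ ((5 : ℝ) / 3)) * J ^ (4 : ℝ) := by gcongr
    _ ≤ _ := by
      have : 0 ≤ Y * L ^ ((5 : ℝ) / 3) * J ^ (4 : ℝ) := by positivity
      nlinarith

end LatticeCircle

/-- There is `C > 0` such that for every `k_F ≥ 2`, every `β ≥ 0`,
and every `f : ℤ³ → [0, ∞]`,
`Σ_k f(k) ⟨k⟩^{2β} D₂(k, k_F) ≤ C k_F^{2/3} (ln k_F)^{5/3} Σ_k f(k) ⟨k⟩^{2β + 4}`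
(an inequality of extended nonnegative reals, trivially true if the right-hand side
is infinite). -/
theorem weighted_D2_sum_bound :
    ∃ C : ℝ, 0 < C ∧ ∀ kF : ℝ, 2 ≤ kF → ∀ β : ℝ, 0 ≤ β →
      ∀ f : (Fin 3 → ℤ) → ℝ≥0∞,
      (∑' k : Fin 3 → ℤ,
          f k * ENNReal.ofReal ((jap k) ^ (2 * β)) * ENNReal.ofReal (Dsum 2 kF k))
        ≤ ENNReal.ofReal (C * kF ^ ((2 : ℝ)/3) * (Real.log kF) ^ ((5 : ℝ)/3)) *
          ∑' k : Fin 3 → ℤ, f k * ENNReal.ofReal ((jap k) ^ (2 * β + 4)) := by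
  refine ⟨800, by norm_num, fun kF hkF β _ f => ?_⟩
  rw [← ENNReal.tsum_mul_left]
  refine ENNReal.tsum_le_tsum fun k => ?_
  have hJ : 0 < jap k := zero_lt_one.trans_le (LatticeCircle.one_le_jap k)
  have hlog : 0 ≤ Real.log kF := Real.log_nonneg (by linarith)
  calc f k * ENNReal.ofReal (jap k ^ (2 * β)) * ENNReal.ofReal (Dsum 2 kF k)
      ≤ f k * ENNReal.ofReal (jap k ^ (2 * β)) * ENNReal.ofReal (800 * kF ^ ((2 : ℝ) / 3) *
          Real.log kF ^ ((5 : ℝ) / 3) * jap k ^ (4 : ℝ)) := by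
        gcongr
        exact LatticeCircle.Dsum_two_le hkF k
    _ = _ := by
        rw [Real.rpow_add hJ, ENNReal.ofReal_mul (p := jap k ^ (2 * β)) (by positivity),
          ENNReal.ofReal_mul (q := jap k ^ (4 : ℝ)) (by positivity)]
        ring
end
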